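/- arXiv:1609.06921 — 5 statements merged into one kernel-verified Lean document; each statement's English description precedes it below -/
import Mathlib

section
/- Let R = M_{n,m}(ℂ) and S = M_{N,M}(ℂ) be rectangular matrix spaces and let φ : R → S be a TRO-morphism. Then there exist a natural number k with k·n ≤ N and k·m ≤ M and unitary matrices U ∈ M_N(ℂ), V ∈ M_M(ℂ) such that φ(A) = U · (diag_k(A) ⊕ 0) · V for every A ∈ M_{n,m}(ℂ), where diag_k(A) ⊕ 0 is the N×M matrix with diag_k(A) as its top-left corner block and zeros elsewhere. -/
open Matrix

/-- The `N × M` matrix having the block-diagonal matrix `diag_k(A)`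
(built from `k` copies of the `n × m` matrix `A`) as its top-left corner block
and zeros elsewhere. -/
noncomputable def diagPad {n m : ℕ} (N M k : ℕ) (A : Matrix (Fin n) (Fin m) ℂ) :
    Matrix (Fin N) (Fin M) ℂ := Matrix.of fun i j =>
  if h : (i : ℕ) % n < n ∧ (j : ℕ) % m < m ∧ (i : ℕ) < k * n ∧ (j : ℕ) < k * m ∧
      (i : ℕ) / n = (j : ℕ) / m
  then A ⟨(i : ℕ) % n, h.1⟩ ⟨(j : ℕ) % m, h.2.1⟩ else 0

namespace Matrix

/-- The columns of a matrix `X` with `Xᴴ * X = 1` are orthonormal. -/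
theorem orthonormal_toLp_col {ι κ : Type*} [Fintype ι] [Fintype κ] [DecidableEq κ]
    {X : Matrix ι κ ℂ} (hX : Xᴴ * X = 1) :
    Orthonormal ℂ fun c => WithLp.toLp 2 (X.col c) := by
  rw [orthonormal_iff_ite]
  intro c d
  have h := congrFun (congrFun hX c) d
  rw [Matrix.mul_apply, Matrix.one_apply] at h
  rw [← h]
  simp [PiLp.inner_apply, mul_comm]

/-- A matrix with orthonormal columns has at most as many columns as rows. -/
theorem card_le_of_conjTranspose_mul_self_eq_one {ι κ : Type*} [Fintype ι] [Fintype κ]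
    [DecidableEq κ] {X : Matrix ι κ ℂ} (hX : Xᴴ * X = 1) :
    Fintype.card κ ≤ Fintype.card ι := by
  simpa using (orthonormal_toLp_col hX).linearIndependent.fintype_card_le_finrank

/-- A matrix with orthonormal columns extends to a unitary matrix, with the given columns placed
at prescribed positions. -/
theorem exists_unitary_extension {ι κ : Type*} [Fintype ι] [DecidableEq ι] [Fintype κ]
    [DecidableEq κ] {X : Matrix ι κ ℂ} (hX : Xᴴ * X = 1) {f : κ → ι}
    (hf : Function.Injective f) :
    ∃ U ∈ unitaryGroup ι ℂ, ∀ a c, U a (f c) = X a c := by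
  have hX' := orthonormal_toLp_col hX
  let v : ι → EuclideanSpace ℂ ι := Function.extend f (fun c => WithLp.toLp 2 (X.col c)) 0
  have hv : Orthonormal ℂ ((Set.range f).domRestrict v) := by
    have : (Set.range f).domRestrict v =
        (fun c => WithLp.toLp 2 (X.col c)) ∘ (Equiv.ofInjective f hf).symm := by
      funext p
      obtain ⟨c, rfl⟩ := (Equiv.ofInjective f hf).surjective p
      simp [v, hf.extend_apply, Set.domRestrict_apply]
    rw [this]
    exact hX'.comp _ (Equiv.injective _)
  obtain ⟨b, hb⟩ := hv.exists_orthonormalBasis_extension_of_card_eq (by simp)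
  refine ⟨Matrix.of fun a p => b p a, ?_, fun a c => ?_⟩
  · rw [mem_unitaryGroup_iff']
    ext p q
    have h := orthonormal_iff_ite.mp b.orthonormal p q
    rw [Matrix.one_apply, ← h]
    simp [Matrix.mul_apply, star_eq_conjTranspose, PiLp.inner_apply, mul_comm]
  · simp [hb (f c) ⟨c, rfl⟩, v, hf.extend_apply]

/-- An orthogonal projection factors through an isometry onto its range. -/
theorem exists_isometry_factorization {ι : Type*} [Fintype ι] [DecidableEq ι]
    {P : Matrix ι ι ℂ} (hP : P.IsHermitian) (hPP : P * P = P) :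
    ∃ (k : ℕ) (W : Matrix ι (Fin k) ℂ), Wᴴ * W = 1 ∧ W * Wᴴ = P := by
  let K := LinearMap.range (toEuclideanLin P)
  let b := stdOrthonormalBasis ℂ K
  let W : Matrix ι (Fin (Module.finrank ℂ K)) ℂ := Matrix.of fun a t => (b t : EuclideanSpace ℂ ι) a
  have hPW : P * W = W := by
    ext a t
    obtain ⟨x, hx⟩ := (b t).2
    have h : toEuclideanLin P (b t : EuclideanSpace ℂ ι) = b t := by
      rw [← hx]
      simp [toLpLin_apply, hPP]
    have := congrArg (fun y : EuclideanSpace ℂ ι => y a) h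
    simpa [toLpLin_apply, W, Matrix.mul_apply, mulVec, dotProduct] using this
  have hWP : W * Wᴴ * P = P := by
    ext a c
    let y : K := ⟨toEuclideanLin P (WithLp.toLp 2 (Pi.single c 1)), ⟨_, rfl⟩⟩
    have h := congrArg (fun y : K => (y : EuclideanSpace ℂ ι) a) (b.sum_repr' y)
    simp only [Submodule.coe_sum, Submodule.coe_smul, Submodule.coe_inner] at h
    rw [Matrix.mul_assoc, Matrix.mul_apply]
    simpa [y, toLpLin_apply, W, Matrix.mul_apply, PiLp.inner_apply, mul_comm] using h
  refine ⟨_, W, ?_, ?_⟩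
  · ext s t
    have h := orthonormal_iff_ite.mp b.orthonormal s t
    rw [Matrix.one_apply, ← h]
    simp [Matrix.mul_apply, Submodule.coe_inner, PiLp.inner_apply, W, mul_comm]
  · have h := congrArg conjTranspose hWP
    rw [conjTranspose_mul, conjTranspose_mul, conjTranspose_conjTranspose, hP.eq,
      ← Matrix.mul_assoc, hPW] at h
    exact h

end Matrix

/-- The position of row (or column) `i` of block `t` in `diag_k`. -/
def blockIndex {k n N : ℕ} (h : k * n ≤ N) (p : Fin k × Fin n) : Fin N :=
  Fin.castLE h (finProdFinEquiv p)

theorem blockIndex_injective {k n N : ℕ} (h : k * n ≤ N) :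
    Function.Injective (blockIndex h) :=
  (Fin.castLE_injective h).comp finProdFinEquiv.injective

theorem mem_range_blockIndex {k n N : ℕ} (h : k * n ≤ N) {p : Fin N} (hp : (p : ℕ) < k * n) :
    p ∈ Set.range (blockIndex h) :=
  ⟨finProdFinEquiv.symm ⟨p, hp⟩, by rw [blockIndex, Equiv.apply_symm_apply]; rfl⟩

theorem diagPad_blockIndex {n m N M k : ℕ} (hn : k * n ≤ N) (hm : k * m ≤ M)
    (A : Matrix (Fin n) (Fin m) ℂ) (p : Fin k × Fin n) (q : Fin k × Fin m) :
    diagPad N M k A (blockIndex hn p) (blockIndex hm q) =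
      if p.1 = q.1 then A p.2 q.2 else 0 := by
  obtain ⟨t, i⟩ := p
  obtain ⟨s, j⟩ := q
  have hi : ((i : ℕ) + n * t) % n = i := by simp [Nat.mod_eq_of_lt i.2]
  have hj : ((j : ℕ) + m * s) % m = j := by simp [Nat.mod_eq_of_lt j.2]
  have hi' : ((i : ℕ) + n * t) / n = t := by
    simp [Nat.add_mul_div_left _ _ i.pos, Nat.div_eq_of_lt i.2]
  have hj' : ((j : ℕ) + m * s) / m = s := by
    simp [Nat.add_mul_div_left _ _ j.pos, Nat.div_eq_of_lt j.2]
  have h1 : (i : ℕ) + n * t < k * n := (finProdFinEquiv (t, i)).2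
  have h2 : (j : ℕ) + m * s < k * m := (finProdFinEquiv (s, j)).2
  simp [diagPad, blockIndex, hi, hj, hi', hj', h1, h2, Fin.ext_iff]

theorem mul_diagPad_mul_apply {n m N M k : ℕ} (hn : k * n ≤ N) (hm : k * m ≤ M)
    (A : Matrix (Fin n) (Fin m) ℂ) (U : Matrix (Fin N) (Fin N) ℂ) (V : Matrix (Fin M) (Fin M) ℂ)
    (a : Fin N) (b : Fin M) :
    (U * diagPad N M k A * V) a b =
      ∑ i, ∑ j, A i j * ∑ t, U a (blockIndex hn (t, i)) * V (blockIndex hm (t, j)) b := by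
  have hcol (q : Fin k × Fin m) : (U * diagPad N M k A) a (blockIndex hm q) =
      ∑ i, U a (blockIndex hn (q.1, i)) * A i q.2 := by
    rw [Matrix.mul_apply, ← Fintype.sum_of_injective (blockIndex hn) (blockIndex_injective hn)
      (fun p => U a (blockIndex hn p) * if p.1 = q.1 then A p.2 q.2 else 0) _ ?_
      (fun p => by rw [diagPad_blockIndex]), Fintype.sum_prod_type_right]
    · simp
    · intro p hp
      have : ¬ (p : ℕ) < k * n := fun h => hp (mem_range_blockIndex hn h)
      simp [diagPad, this]
  rw [Matrix.mul_apply, ← Fintype.sum_of_injective (blockIndex hm) (blockIndex_injective hm)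
    (fun q => (∑ i, U a (blockIndex hn (q.1, i)) * A i q.2) * V (blockIndex hm q) b) _ ?_
    (fun q => by rw [hcol]), Fintype.sum_prod_type_right]
  · rw [Finset.sum_comm (s := (Finset.univ : Finset (Fin n)))]
    refine Finset.sum_congr rfl fun j _ => ?_
    simp only [Finset.sum_mul, Finset.mul_sum]
    rw [Finset.sum_comm]
    exact Finset.sum_congr rfl fun i _ => Finset.sum_congr rfl fun t _ => by ring
  · intro q hq
    have : ¬ (q : ℕ) < k * m := fun h => hq (mem_range_blockIndex hm h)
    simp [Matrix.mul_apply, diagPad, this]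

/-- The images of the matrix units under a TRO-morphism multiply like matrix units. -/
theorem tro_morphism_single {n m N M : ℕ}
    {φ : Matrix (Fin n) (Fin m) ℂ →ₗ[ℂ] Matrix (Fin N) (Fin M) ℂ}
    (hφ : ∀ x y z : Matrix (Fin n) (Fin m) ℂ, φ (x * yᴴ * z) = φ x * (φ y)ᴴ * φ z)
    (i l p : Fin n) (j r q : Fin m) :
    φ (single i j 1) * (φ (single l r 1))ᴴ * φ (single p q 1) =
      if j = r ∧ l = p then φ (single i q 1) else 0 := by
  rw [← hφ, conjTranspose_single]
  split_ifs with h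
  · obtain ⟨rfl, rfl⟩ := h
    simp
  · by_cases hj : j = r
    · subst hj
      have hl : l ≠ p := fun hl => h ⟨rfl, hl⟩
      simp [hl]
    · simp [hj]

/-- A TRO-morphism is determined by two matrices with orthonormal columns. -/
theorem tro_morphism_exists_isometries {n m N M : ℕ} [NeZero n] [NeZero m]
    {φ : Matrix (Fin n) (Fin m) ℂ →ₗ[ℂ] Matrix (Fin N) (Fin M) ℂ}
    (hφ : ∀ x y z : Matrix (Fin n) (Fin m) ℂ, φ (x * yᴴ * z) = φ x * (φ y)ᴴ * φ z) :
    ∃ (k : ℕ) (X : Matrix (Fin N) (Fin k × Fin n) ℂ) (Y : Matrix (Fin M) (Fin k × Fin m) ℂ),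
      Xᴴ * X = 1 ∧ Yᴴ * Y = 1 ∧
        ∀ i j a b, φ (single i j 1) a b = ∑ t, X a (t, i) * star (Y b (t, j)) := by
  set F : Fin n → Fin m → Matrix (Fin N) (Fin M) ℂ := fun i j => φ (single i j 1) with hF
  have hmul (i l p : Fin n) (j r q : Fin m) :
      F i j * (F l r)ᴴ * F p q = if j = r ∧ l = p then F i q else 0 :=
    tro_morphism_single hφ i l p j r q
  have hmul' (i l p : Fin n) (j r q : Fin m) :
      F i j * ((F l r)ᴴ * F p q) = if j = r ∧ l = p then F i q else 0 := by
    rw [← Matrix.mul_assoc, hmul]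
  obtain ⟨k, W, hWW, hP⟩ := exists_isometry_factorization (P := (F 0 0)ᴴ * F 0 0)
    (isHermitian_conjTranspose_mul_self _) (by simp [Matrix.mul_assoc, hmul'])
  have hPW : (F 0 0)ᴴ * F 0 0 * W = W := by rw [← hP, Matrix.mul_assoc, hWW, Matrix.mul_one]
  have hWP : Wᴴ * ((F 0 0)ᴴ * F 0 0) = Wᴴ := by
    rw [← hP, ← Matrix.mul_assoc, hWW, Matrix.one_mul]
  have hX (i l : Fin n) : (F i 0 * W)ᴴ * (F l 0 * W) = if i = l then 1 else 0 := by
    calc (F i 0 * W)ᴴ * (F l 0 * W) = Wᴴ * ((F i 0)ᴴ * F l 0) * W := by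
          simp only [conjTranspose_mul, Matrix.mul_assoc]
      _ = Wᴴ * ((F 0 0)ᴴ * (F 0 0 * ((F i 0)ᴴ * F l 0))) * W := by
          rw [← Matrix.mul_assoc (F 0 0)ᴴ, ← Matrix.mul_assoc Wᴴ ((F 0 0)ᴴ * F 0 0), hWP]
      _ = _ := by
          rw [hmul']
          split_ifs with h1 h2 h2 <;> simp_all
  have hY (j r : Fin m) : ((F 0 j)ᴴ * F 0 0 * W)ᴴ * ((F 0 r)ᴴ * F 0 0 * W) =
      if j = r then 1 else 0 := by
    calc ((F 0 j)ᴴ * F 0 0 * W)ᴴ * ((F 0 r)ᴴ * F 0 0 * W)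
        = Wᴴ * ((F 0 0)ᴴ * (F 0 j * ((F 0 r)ᴴ * F 0 0))) * W := by
          simp only [conjTranspose_mul, conjTranspose_conjTranspose, Matrix.mul_assoc]
      _ = _ := by
          rw [hmul']
          split_ifs with h1 h2 h2 <;> simp_all
  refine ⟨k, Matrix.of fun a p => (F p.2 0 * W) a p.1,
    Matrix.of fun b p => ((F 0 p.2)ᴴ * F 0 0 * W) b p.1, ?_, ?_, fun i j a b => ?_⟩
  · ext ⟨t, i⟩ ⟨s, l⟩
    have h := congrFun (congrFun (hX i l) t) s
    rw [Matrix.mul_apply] at h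
    rw [Matrix.mul_apply]
    simp only [conjTranspose_apply, Matrix.of_apply] at h ⊢
    rw [h]
    split_ifs with hil <;> simp [Matrix.one_apply, hil]
  · ext ⟨t, i⟩ ⟨s, l⟩
    have h := congrFun (congrFun (hY i l) t) s
    rw [Matrix.mul_apply] at h
    rw [Matrix.mul_apply]
    simp only [conjTranspose_apply, Matrix.of_apply] at h ⊢
    rw [h]
    split_ifs with hil <;> simp [Matrix.one_apply, hil]
  · have h : F i 0 * W * ((F 0 j)ᴴ * F 0 0 * W)ᴴ = F i j := by
      calc F i 0 * W * ((F 0 j)ᴴ * F 0 0 * W)ᴴ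
          = F i 0 * (W * Wᴴ) * ((F 0 0)ᴴ * F 0 j) := by
            simp only [conjTranspose_mul, conjTranspose_conjTranspose, Matrix.mul_assoc]
        _ = F i j := by
            rw [hP, hmul' i 0 0 0 0 0]
            simp [hmul']
    change F i j a b = _
    rw [← h, Matrix.mul_apply]
    rfl

/-- every TRO-morphism `φ : M_{n,m}(ℂ) → M_{N,M}(ℂ)` is, up to unitaries,
a `k`-fold diagonal embedding. -/
theorem tro_morphism_rectangular_standard_form (n m N M : ℕ)
    (φ : Matrix (Fin n) (Fin m) ℂ →ₗ[ℂ] Matrix (Fin N) (Fin M) ℂ)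
    (hφ : ∀ x y z : Matrix (Fin n) (Fin m) ℂ, φ (x * yᴴ * z) = φ x * (φ y)ᴴ * φ z) :
    ∃ k : ℕ, k * n ≤ N ∧ k * m ≤ M ∧
      ∃ U ∈ Matrix.unitaryGroup (Fin N) ℂ, ∃ V ∈ Matrix.unitaryGroup (Fin M) ℂ,
        ∀ A : Matrix (Fin n) (Fin m) ℂ, φ A = U * diagPad N M k A * V := by
  by_cases h0 : n = 0 ∨ m = 0
  · refine ⟨0, by simp, by simp, 1, one_mem _, 1, one_mem _, fun A => ?_⟩
    have hA : A = 0 := by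
      ext i j
      rcases h0 with rfl | rfl
      · exact i.elim0
      · exact j.elim0
    ext a b
    simp [hA, diagPad]
  push Not at h0
  have : NeZero n := ⟨h0.1⟩
  have : NeZero m := ⟨h0.2⟩
  obtain ⟨k, X, Y, hX, hY, hXY⟩ := tro_morphism_exists_isometries hφ
  have hn : k * n ≤ N := by simpa using card_le_of_conjTranspose_mul_self_eq_one hX
  have hm : k * m ≤ M := by simpa using card_le_of_conjTranspose_mul_self_eq_one hY
  obtain ⟨U, hU, hUX⟩ := exists_unitary_extension hX (blockIndex_injective hn)
  obtain ⟨V, hV, hVY⟩ := exists_unitary_extension hY (blockIndex_injective hm)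
  refine ⟨k, hn, hm, U, hU, star V, Unitary.star_mem hV, fun A => ?_⟩
  ext a b
  rw [mul_diagPad_mul_apply hn hm]
  conv_lhs => rw [matrix_eq_sum_single A]
  simp only [map_sum, Matrix.sum_apply, star_apply, hUX, hVY, ← hXY]
  refine Finset.sum_congr rfl fun i _ => Finset.sum_congr rfl fun j _ => ?_
  rw [← mul_one (A i j), ← smul_eq_mul, ← smul_single, map_smul]
  simp
end

section
/- Let m,n ≥ 2 and let φ : M_{m,n}(ℂ) → M_{M,N}(ℂ) be a triple morphism. Then there exist natural numbers α, β with α·m + β·n ≤ M and α·n + β·m ≤ N, and unitary matrices U ∈ M_M(ℂ), V ∈ M_N(ℂ), such that for every A ∈ M_{m,n}(ℂ), φ(A) = U · D(A) · V, where D(A) is the M×N matrix whose top-left corner is the block-diagonal matrix with diagonal blocks diag_α(A) and diag_β(Aᵀ) and which is zero elsewhere. -/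
open Matrix

/-- The `N × M` matrix having the block-diagonal matrix `diag_k(A)` (built from `k`
copies of the `n × m` matrix `A`) as a block whose top-left corner sits at row `r`
and column `c`, and zeros elsewhere. -/
noncomputable def diagPadAt {n m : ℕ} (N M r c k : ℕ) (A : Matrix (Fin n) (Fin m) ℂ) :
    Matrix (Fin N) (Fin M) ℂ := Matrix.of fun i j =>
  if h : r ≤ (i : ℕ) ∧ c ≤ (j : ℕ) ∧ ((i : ℕ) - r) % n < n ∧ ((j : ℕ) - c) % m < m ∧
      (i : ℕ) - r < k * n ∧ (j : ℕ) - c < k * m ∧ ((i : ℕ) - r) / n = ((j : ℕ) - c) / m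
  then A ⟨((i : ℕ) - r) % n, h.2.2.1⟩ ⟨((j : ℕ) - c) % m, h.2.2.2.1⟩ else 0

section Grid

variable {ι κ M N : Type*} [DecidableEq ι] [DecidableEq κ] [Fintype M] [Fintype N]

/-- The Jordan triple product relations satisfied by the images `u i j` of the matrix units. -/
def IsTripleGrid (u : ι → κ → Matrix M N ℂ) : Prop :=
  ∀ i j k l p q, u i j * (u k l)ᴴ * u p q + u p q * (u k l)ᴴ * u i j =
    (if j = l ∧ k = p then u i q else 0) + (if q = l ∧ k = i then u p j else 0)

/-- The associative ternary relations `e i j * (e k l)ᴴ * e p q = δ j l • δ k p • e i q` of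
matrix units. -/
structure IsTernaryUnits (a : ι → κ → Matrix M N ℂ) : Prop where
  mul_conjTranspose_eq_zero : ∀ i k {j l}, j ≠ l → a i j * (a k l)ᴴ = 0
  conjTranspose_mul_eq_zero : ∀ {i k} j l, i ≠ k → (a i j)ᴴ * a k l = 0
  mul_mul : ∀ i j k q, a i j * (a k j)ᴴ * a k q = a i q


namespace IsTripleGrid

variable {u : ι → κ → Matrix M N ℂ}

theorem transpose (hu : IsTripleGrid u) : IsTripleGrid fun j i => u i j := by
  intro j i l k q p
  rw [hu i j k l p q, add_comm]
  congr 1 <;> simp only [eq_comm, and_comm]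

theorem mul_mul_self (hu : IsTripleGrid u) (i : ι) (j : κ) : u i j * (u i j)ᴴ * u i j = u i j := by
  have h := hu i j i j i j
  simp only [and_self, if_true, ← two_smul ℂ] at h
  exact smul_right_injective _ two_ne_zero h

theorem conjTranspose_mul_mul_self (hu : IsTripleGrid u) (i : ι) (j : κ) :
    (u i j)ᴴ * u i j * (u i j)ᴴ = (u i j)ᴴ := by
  simpa [Matrix.mul_assoc] using congrArg conjTranspose (hu.mul_mul_self i j)

theorem conjTranspose_mul_eq_zero (hu : IsTripleGrid u) {i k : ι} {j l : κ} (hik : i ≠ k)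
    (hjl : j ≠ l) : (u i j)ᴴ * u k l = 0 := by
  have h := hu i j i j k l
  simp only [hik, hjl.symm, and_false, false_and, if_false, add_zero] at h
  have hp := hu.mul_mul_self i j
  have hp' := hu.conjTranspose_mul_mul_self i j
  have h1 : (u i j)ᴴ * u k l + (u i j)ᴴ * u k l * ((u i j)ᴴ * u i j) = 0 := by
    have := congrArg (fun x => (u i j)ᴴ * x) h
    simp only [Matrix.mul_add, ← Matrix.mul_assoc, hp', Matrix.mul_zero] at this
    simpa only [Matrix.mul_assoc] using this
  have hQ : (u i j)ᴴ * u i j * ((u i j)ᴴ * u i j) = (u i j)ᴴ * u i j := by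
    rw [← Matrix.mul_assoc, hp']
  have h2 : (u i j)ᴴ * u k l * ((u i j)ᴴ * u i j) = 0 := by
    have := congrArg (fun x => x * ((u i j)ᴴ * u i j)) h1
    simp only [Matrix.add_mul, Matrix.zero_mul] at this
    rw [Matrix.mul_assoc _ (_ * _) (_ * _), hQ, ← two_smul ℂ, smul_eq_zero] at this
    exact this.resolve_left two_ne_zero
  simpa [h2] using h1

theorem conjTranspose (hu : IsTripleGrid u) : IsTripleGrid fun j i => (u i j)ᴴ := by
  intro j i l k q p
  have := congrArg Matrix.conjTranspose (hu i j k l p q)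
  simp only [conjTranspose_add, conjTranspose_mul, conjTranspose_conjTranspose,
    ← Matrix.mul_assoc, apply_ite Matrix.conjTranspose, conjTranspose_zero] at this
  rw [conjTranspose_conjTranspose, add_comm, this, add_comm]
  congr 1 <;> simp only [eq_comm, and_comm]

theorem mul_conjTranspose_eq_zero (hu : IsTripleGrid u) {i k : ι} {j l : κ} (hik : i ≠ k)
    (hjl : j ≠ l) : u i j * (u k l)ᴴ = 0 := by
  simpa using hu.conjTranspose.conjTranspose_mul_eq_zero hjl hik

theorem eq_add (hu : IsTripleGrid u) (i : ι) {j l : κ} (hjl : j ≠ l) :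
    u i j = u i l * (u i l)ᴴ * u i j + u i j * ((u i l)ᴴ * u i l) := by
  simpa [hjl, Matrix.mul_assoc, eq_comm] using hu i l i l i j

theorem quadrangle (hu : IsTripleGrid u) {i k : ι} {j l : κ} (hik : i ≠ k) (hjl : j ≠ l) :
    u i j = u i l * (u k l)ᴴ * u k j + u k j * (u k l)ᴴ * u i l := by
  simpa [hik.symm, hjl, eq_comm] using hu i l k l k j

theorem left_eq (hu : IsTripleGrid u) {i k : ι} {j l : κ} (hik : i ≠ k) (hjl : j ≠ l) :
    u i l * (u i l)ᴴ * u i j = u i l * (u k l)ᴴ * u k j := by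
  conv_lhs => rw [hu.quadrangle hik hjl]
  have h : u i l * (u i l)ᴴ * u k j = 0 := by
    rw [Matrix.mul_assoc, hu.conjTranspose_mul_eq_zero hik hjl.symm, Matrix.mul_zero]
  simp only [Matrix.mul_add, ← Matrix.mul_assoc, hu.mul_mul_self, h, Matrix.zero_mul, add_zero]

theorem right_eq (hu : IsTripleGrid u) {i k : ι} {j l : κ} (hik : i ≠ k) (hjl : j ≠ l) :
    u i j * ((u k j)ᴴ * u k j) = u i l * (u k l)ᴴ * u k j := by
  conv_lhs => rw [hu.quadrangle hik hjl]
  rw [Matrix.add_mul, Matrix.mul_assoc _ (u k j), ← Matrix.mul_assoc (u k j), hu.mul_mul_self,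
    Matrix.mul_assoc _ (u i l), ← Matrix.mul_assoc (u i l),
    hu.mul_conjTranspose_eq_zero hik hjl.symm]
  simp

/-- The associative part of a triple grid. -/
theorem exists_assocPart [Nontrivial ι] [Nontrivial κ] (hu : IsTripleGrid u) :
    ∃ a : ι → κ → Matrix M N ℂ,
      (∀ i j l, j ≠ l → a i j = u i l * (u i l)ᴴ * u i j) ∧
      (∀ i j k, i ≠ k → a i j = u i j * ((u k j)ᴴ * u k j)) := by
  choose σ hσ using fun i : ι => exists_ne i
  choose τ hτ using fun j : κ => exists_ne j
  refine ⟨fun i j => u i j * ((u (σ i) j)ᴴ * u (σ i) j), fun i j l h => ?_, fun i j k h => ?_⟩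
  · simp only
    rw [hu.left_eq (hσ i).symm h, hu.right_eq (hσ i).symm h]
  · simp only
    rw [hu.right_eq h (hτ j).symm, hu.right_eq (hσ i).symm (hτ j).symm,
      ← hu.left_eq h (hτ j).symm, ← hu.left_eq (hσ i).symm (hτ j).symm]

variable {a : ι → κ → Matrix M N ℂ}

theorem proj_mul (hu : IsTripleGrid u) [Nontrivial ι]
    (hl : ∀ i j l, j ≠ l → a i j = u i l * (u i l)ᴴ * u i j)
    (hr : ∀ i j k, i ≠ k → a i j = u i j * ((u k j)ᴴ * u k j)) (i : ι) (j l : κ) :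
    u i l * (u i l)ᴴ * a i j = a i j := by
  by_cases h : j = l
  · subst h
    obtain ⟨k, hk⟩ := exists_ne i
    rw [hr i j k hk.symm, ← Matrix.mul_assoc, hu.mul_mul_self]
  · rw [hl i j l h]
    simp only [← Matrix.mul_assoc, hu.mul_mul_self]

theorem mul_proj (hu : IsTripleGrid u) [Nontrivial κ]
    (hl : ∀ i j l, j ≠ l → a i j = u i l * (u i l)ᴴ * u i j)
    (hr : ∀ i j k, i ≠ k → a i j = u i j * ((u k j)ᴴ * u k j)) (i k : ι) (j : κ) :
    a i j * ((u k j)ᴴ * u k j) = a i j := by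
  by_cases h : i = k
  · subst h
    obtain ⟨l, hlj⟩ := exists_ne j
    rw [hl i j l hlj.symm, Matrix.mul_assoc, ← Matrix.mul_assoc (u i j), hu.mul_mul_self]
  · rw [hr i j k h]
    simp only [← Matrix.mul_assoc]
    rw [Matrix.mul_assoc _ (u k j), Matrix.mul_assoc _ (u k j * _), hu.mul_mul_self]

theorem isTernaryUnits (hu : IsTripleGrid u) [Nontrivial ι] [Nontrivial κ]
    (hl : ∀ i j l, j ≠ l → a i j = u i l * (u i l)ᴴ * u i j)
    (hr : ∀ i j k, i ≠ k → a i j = u i j * ((u k j)ᴴ * u k j)) : IsTernaryUnits a where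
  mul_conjTranspose_eq_zero i k j l h := by
    obtain ⟨p, q, hpq⟩ := exists_pair_ne ι
    rw [← hu.mul_proj hl hr i p j, ← hu.mul_proj hl hr k q l]
    simp only [conjTranspose_mul, conjTranspose_conjTranspose, ← Matrix.mul_assoc]
    rw [Matrix.mul_assoc _ (u p j), hu.mul_conjTranspose_eq_zero hpq h]
    simp
  conjTranspose_mul_eq_zero {i k} j l h := by
    obtain ⟨p, q, hpq⟩ := exists_pair_ne κ
    rw [← hu.proj_mul hl hr i j p, ← hu.proj_mul hl hr k l q]
    simp only [conjTranspose_mul, conjTranspose_conjTranspose, ← Matrix.mul_assoc]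
    rw [Matrix.mul_assoc _ _ (u k q), hu.conjTranspose_mul_eq_zero h hpq]
    simp
  mul_mul i j k q := by
    have hP := hu.proj_mul hl hr
    have hQ := hu.mul_proj hl hr
    obtain ⟨l, hlj⟩ := exists_ne j
    have h0 : (a k j)ᴴ * a k q = (u k j)ᴴ * a k q := by
      rw [hl k j l hlj.symm]
      simp only [conjTranspose_mul, conjTranspose_conjTranspose]
      rw [Matrix.mul_assoc, hP]
    rw [Matrix.mul_assoc, h0]
    by_cases hik : i = k
    · subst hik
      rw [hl i j l hlj.symm, Matrix.mul_assoc _ (u i j), ← Matrix.mul_assoc (u i j), hP, hP]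
    by_cases hjq : j = q
    · subst hjq
      rw [hr k j i (Ne.symm hik), ← Matrix.mul_assoc (u k j)ᴴ, ← Matrix.mul_assoc (a i j), hQ, hQ]
    have e1 : a k q = u k j * (u i j)ᴴ * u i q := by
      rw [hl k q j (Ne.symm hjq), hu.left_eq (Ne.symm hik) (Ne.symm hjq)]
    have e2 : a i j = u i q * (u k q)ᴴ * u k j := by
      rw [hl i j q hjq, hu.left_eq hik hjq]
    have e3 : a i j * ((u k j)ᴴ * a k q) = a i j * ((u i j)ᴴ * u i q) := by
      conv_rhs => rw [← hQ i k j]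
      rw [e1]
      simp only [Matrix.mul_assoc]
    have e4 : a i j * ((u i j)ᴴ * u i q) = u i q * ((u k q)ᴴ * a k q) := by
      rw [e1, e2]
      simp only [Matrix.mul_assoc]
    rw [e3, e4, hr k q i (Ne.symm hik), ← Matrix.mul_assoc (u k q)ᴴ, ← Matrix.mul_assoc (u i q),
      ← hr i q k hik, hQ]

theorem exists_decomposition (hu : IsTripleGrid u) [Nontrivial ι] [Nontrivial κ] :
    ∃ (a : ι → κ → Matrix M N ℂ) (b : κ → ι → Matrix M N ℂ),
      IsTernaryUnits a ∧ IsTernaryUnits b ∧ (∀ i j, u i j = a i j + b j i) ∧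
      (∀ i j k l, a i j * (b l k)ᴴ = 0) ∧ (∀ i j k l, (a i j)ᴴ * b l k = 0) := by
  obtain ⟨a, hl, hr⟩ := hu.exists_assocPart
  obtain ⟨b, hl', hr'⟩ := hu.transpose.exists_assocPart
  refine ⟨a, b, hu.isTernaryUnits hl hr, hu.transpose.isTernaryUnits hl' hr', fun i j => ?_,
    fun i j k l => ?_, fun i j k l => ?_⟩
  · obtain ⟨l, h⟩ := exists_ne j
    rw [hl i j l h.symm, hr' j i l h.symm]
    exact hu.eq_add i h.symm
  · obtain ⟨p, hp⟩ := exists_ne k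
    obtain ⟨r, hr0⟩ := exists_ne j
    rw [← hu.mul_proj hl hr i p j, ← hu.transpose.mul_proj hl' hr' l r k]
    simp only [conjTranspose_mul, conjTranspose_conjTranspose, ← Matrix.mul_assoc]
    rw [Matrix.mul_assoc _ (u p j), hu.mul_conjTranspose_eq_zero hp hr0.symm]
    simp
  · obtain ⟨p, hp⟩ := exists_ne i
    obtain ⟨r, hr0⟩ := exists_ne l
    rw [← hu.proj_mul hl hr i j r, ← hu.transpose.proj_mul hl' hr' l k p]
    simp only [conjTranspose_mul, conjTranspose_conjTranspose, ← Matrix.mul_assoc]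
    rw [Matrix.mul_assoc _ _ (u p l), hu.conjTranspose_mul_eq_zero hp.symm hr0]
    simp

end IsTripleGrid

theorem Matrix.exists_isometry_of_isProj [DecidableEq N] {Q : Matrix N N ℂ} (hQ : Qᴴ = Q) (hQ2 : Q * Q = Q) :
    ∃ (α : ℕ) (X : Matrix N (Fin α) ℂ), Xᴴ * X = 1 ∧ X * Xᴴ = Q := by
  have hH : Q.IsHermitian := hQ
  set U : Matrix N N ℂ := (hH.eigenvectorUnitary : Matrix N N ℂ)
  have hUU : Uᴴ * U = 1 := (Matrix.mem_unitaryGroup_iff'.1 hH.eigenvectorUnitary.2)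
  have hUU' : U * Uᴴ = 1 := (Matrix.mem_unitaryGroup_iff.1 hH.eigenvectorUnitary.2)
  set d : N → ℂ := fun i => (hH.eigenvalues i : ℂ)
  have hs : Q = U * diagonal d * Uᴴ := by
    have := hH.spectral_theorem
    rw [Unitary.conjStarAlgAut_apply] at this
    exact this
  have hdiag : Uᴴ * Q * U = diagonal d := by
    rw [hs]
    calc _ = (Uᴴ * U) * diagonal d * (Uᴴ * U) := by simp only [Matrix.mul_assoc]
      _ = _ := by rw [hUU]; simp
  have hd2 : ∀ i, d i = 0 ∨ d i = 1 := by
    have h : diagonal d * diagonal d = diagonal d := by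
      rw [← hdiag]
      calc _ = Uᴴ * Q * (U * Uᴴ) * Q * U := by simp only [Matrix.mul_assoc]
        _ = Uᴴ * (Q * Q) * U := by rw [hUU']; simp only [Matrix.mul_assoc, Matrix.one_mul]
        _ = _ := by rw [hQ2]
    intro i
    have := congrFun (congrFun h i) i
    simp only [diagonal_mul_diagonal, diagonal_apply_eq] at this
    have h' : d i * (d i - 1) = 0 := by linear_combination this
    rcases mul_eq_zero.1 h' with h | h
    · exact Or.inl h
    · exact Or.inr (sub_eq_zero.1 h)
  classical
  let e := (Fintype.equivFin {i // d i = 1}).symm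
  refine ⟨_, U.submatrix id (fun c => (e c : N)), ?_, ?_⟩
  · ext c c'
    have := congrFun (congrFun hUU (e c)) (e c')
    simp only [Matrix.mul_apply, conjTranspose_apply, submatrix_apply, id] at this ⊢
    rw [this]
    simp [Matrix.one_apply, Subtype.coe_injective.eq_iff]
  · ext x y
    rw [hs]
    rw [Matrix.mul_apply, Matrix.mul_apply]
    simp only [conjTranspose_apply, submatrix_apply, id, mul_diagonal]
    refine Fintype.sum_of_injective (fun c => (e c : N))
      (Subtype.coe_injective.comp e.injective) _ _ (fun i hi => ?_) (fun c => ?_)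
    · rcases hd2 i with h | h
      · simp [h]
      · exact absurd ⟨e.symm ⟨i, h⟩, by simp⟩ hi
    · simp [(e c).2]

theorem IsTernaryUnits.exists_factorization [Nonempty ι] [Nonempty κ]
    {a : ι → κ → Matrix M N ℂ} (ha : IsTernaryUnits a) :
    ∃ (α : ℕ) (G : ι → Matrix M (Fin α) ℂ) (F : κ → Matrix N (Fin α) ℂ),
      (∀ i k, (G i)ᴴ * G k = if i = k then 1 else 0) ∧
      (∀ j l, (F j)ᴴ * F l = if j = l then 1 else 0) ∧ ∀ i j, a i j = G i * (F j)ᴴ := by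
  classical
  obtain ⟨i₀⟩ := ‹Nonempty ι›
  obtain ⟨j₀⟩ := ‹Nonempty κ›
  set Q := (a i₀ j₀)ᴴ * a i₀ j₀ with hQ
  have hQH : Qᴴ = Q := by simp [hQ]
  have haQ : ∀ i, a i j₀ * Q = a i j₀ := fun i => by rw [hQ, ← Matrix.mul_assoc, ha.mul_mul]
  have hQQ : Q * Q = Q := by
    conv_lhs => enter [1]; rw [hQ]
    rw [Matrix.mul_assoc, haQ]
  obtain ⟨α, X, hX, hXQ⟩ := exists_isometry_of_isProj hQH hQQ
  have hQX : Xᴴ * Q * X = 1 := by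
    rw [← hXQ, ← Matrix.mul_assoc, hX, Matrix.one_mul, hX]
  refine ⟨α, fun i => a i j₀ * X, fun j => (a i₀ j)ᴴ * (a i₀ j₀ * X), fun i k => ?_,
    fun j l => ?_, fun i j => ?_⟩
  · split_ifs with h
    · subst h
      have : (a i j₀)ᴴ * a i j₀ = Q := by
        rw [← haQ i, conjTranspose_mul, hQH, haQ, Matrix.mul_assoc]
        conv_lhs => rw [hQ, Matrix.mul_assoc, ← Matrix.mul_assoc (a i₀ j₀), ha.mul_mul]
      rw [conjTranspose_mul, Matrix.mul_assoc, ← Matrix.mul_assoc _ _ X, this,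
        ← Matrix.mul_assoc, hQX]
    · rw [conjTranspose_mul, Matrix.mul_assoc, ← Matrix.mul_assoc _ _ X,
        ha.conjTranspose_mul_eq_zero _ _ h]
      simp
  · split_ifs with h
    · subst h
      rw [conjTranspose_mul, conjTranspose_conjTranspose, Matrix.mul_assoc,
        ← Matrix.mul_assoc (a i₀ j), ← Matrix.mul_assoc _ _ X, ha.mul_mul, conjTranspose_mul,
        ← Matrix.mul_assoc, Matrix.mul_assoc Xᴴ, hQX]
    · simp only [conjTranspose_mul, conjTranspose_conjTranspose]
      rw [Matrix.mul_assoc, ← Matrix.mul_assoc (a i₀ j), ha.mul_conjTranspose_eq_zero _ _ h]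
      simp
  · simp only [conjTranspose_mul, conjTranspose_conjTranspose]
    calc a i j = a i j₀ * Q * (a i₀ j₀)ᴴ * a i₀ j := by rw [haQ, ha.mul_mul]
      _ = _ := by rw [← hXQ]; simp only [Matrix.mul_assoc]

end Grid

theorem Matrix.card_le_of_conjTranspose_mul_self {M K : Type*} [Fintype M] [Fintype K]
    [DecidableEq K] {G : Matrix M K ℂ} (hG : Gᴴ * G = 1) : Fintype.card K ≤ Fintype.card M := by
  rw [← Matrix.rank_one (R := ℂ) (n := K), ← hG]
  exact (Matrix.rank_mul_le_right _ _).trans (Matrix.rank_le_card_height _)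

theorem Matrix.exists_unitary_extension_s2 {M K : Type*} [Fintype M] [DecidableEq M] [Fintype K]
    [DecidableEq K] {G : Matrix M K ℂ} (hG : Gᴴ * G = 1) {e : K → M}
    (he : Function.Injective e) :
    ∃ U ∈ Matrix.unitaryGroup M ℂ, ∀ x k, U x (e k) = G x k := by
  classical
  let v : M → EuclideanSpace ℂ M :=
    Function.extend e (fun k => WithLp.toLp 2 fun x => G x k) 0
  have hve : ∀ k, v (e k) = WithLp.toLp 2 fun x => G x k := fun k => he.extend_apply _ _ k
  have hv : Orthonormal ℂ ((Set.range e).domRestrict v) := by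
    rw [orthonormal_iff_ite]
    rintro ⟨x, hx⟩ ⟨y, hy⟩
    obtain ⟨k, rfl⟩ := Set.mem_range.1 hx
    obtain ⟨l, rfl⟩ := Set.mem_range.1 hy
    have := congrFun (congrFun hG k) l
    simp only [Matrix.mul_apply, conjTranspose_apply, Matrix.one_apply] at this
    have hkl : (⟨e k, hx⟩ : Set.range e) = ⟨e l, hy⟩ ↔ k = l := by
      rw [Subtype.mk.injEq, he.eq_iff]
    simp only [Set.domRestrict_apply, hve, hkl, PiLp.inner_apply, RCLike.inner_apply]
    rw [← this]
    exact Finset.sum_congr rfl fun x _ => mul_comm (G x l) _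
  obtain ⟨b, hb⟩ := hv.exists_orthonormalBasis_extension_of_card_eq (by simp)
  refine ⟨Matrix.of fun x y => b y x, ?_, fun x k => ?_⟩
  · rw [Matrix.mem_unitaryGroup_iff']
    ext y z
    have := orthonormal_iff_ite.1 b.orthonormal y z
    rw [PiLp.inner_apply] at this
    simp only [RCLike.inner_apply] at this
    simp only [star_eq_conjTranspose, Matrix.mul_apply, conjTranspose_apply, of_apply,
      Matrix.one_apply]
    rw [← this]
    exact Finset.sum_congr rfl fun x _ => mul_comm _ _
  · simp [hb _ ⟨k, rfl⟩, hve]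

section DiagPad

variable {n m N M r c k : ℕ} {e₁ : Fin k × Fin n → Fin N} {e₂ : Fin k × Fin m → Fin M}

theorem diagPadAt_apply_block (he₁ : ∀ p, (e₁ p : ℕ) = r + (p.2 + n * p.1))
    (he₂ : ∀ p, (e₂ p : ℕ) = c + (p.2 + m * p.1)) (A : Matrix (Fin n) (Fin m) ℂ)
    (b b' : Fin k) (i : Fin n) (j : Fin m) :
    diagPadAt N M r c k A (e₁ (b, i)) (e₂ (b', j)) = if b = b' then A i j else 0 := by
  have hn : 0 < n := i.pos
  have hm : 0 < m := j.pos
  have h1 : (i : ℕ) + n * b < k * n := by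
    have := finProdFinEquiv (b, i) |>.2
    simpa using this
  have h2 : (j : ℕ) + m * b' < k * m := by
    have := finProdFinEquiv (b', j) |>.2
    simpa using this
  simp [diagPadAt, he₁, he₂, Nat.mod_lt, hn, hm, h1, h2, Nat.add_mul_div_left, Nat.mod_eq_of_lt,
    Nat.div_eq_of_lt, Fin.ext_iff]

theorem diagPadAt_eq_zero_of_row (he₁ : ∀ p, (e₁ p : ℕ) = r + (p.2 + n * p.1))
    (A : Matrix (Fin n) (Fin m) ℂ) {x : Fin N} (hx : x ∉ Set.range e₁) (y : Fin M) :
    diagPadAt N M r c k A x y = 0 := by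
  rw [diagPadAt, of_apply, dif_neg]
  rintro ⟨h, -, h1, -, h2, -⟩
  refine hx ⟨(⟨(x - r) / n, Nat.div_lt_of_lt_mul (by rwa [mul_comm])⟩, ⟨(x - r) % n, h1⟩), ?_⟩
  rw [Fin.ext_iff, he₁]
  simp only [Nat.mod_add_div]
  omega

theorem diagPadAt_eq_zero_of_col (he₂ : ∀ p, (e₂ p : ℕ) = c + (p.2 + m * p.1))
    (A : Matrix (Fin n) (Fin m) ℂ) (x : Fin N) {y : Fin M} (hy : y ∉ Set.range e₂) :
    diagPadAt N M r c k A x y = 0 := by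
  rw [diagPadAt, of_apply, dif_neg]
  rintro ⟨-, h, -, h1, -, h2, -⟩
  refine hy ⟨(⟨(y - c) / m, Nat.div_lt_of_lt_mul (by rwa [mul_comm])⟩, ⟨(y - c) % m, h1⟩), ?_⟩
  rw [Fin.ext_iff, he₂]
  simp only [Nat.mod_add_div]
  omega

theorem mul_diagPadAt_mul_conjTranspose {P Q : Type*}
    (he₁ : ∀ p, (e₁ p : ℕ) = r + (p.2 + n * p.1)) (he₁' : Function.Injective e₁)
    (he₂ : ∀ p, (e₂ p : ℕ) = c + (p.2 + m * p.1)) (he₂' : Function.Injective e₂)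
    (A : Matrix (Fin n) (Fin m) ℂ) (U : Matrix P (Fin N) ℂ) (W : Matrix Q (Fin M) ℂ) :
    U * diagPadAt N M r c k A * Wᴴ = ∑ i, ∑ j, A i j •
      (U.submatrix id (fun b => e₁ (b, i)) * (W.submatrix id (fun b => e₂ (b, j)))ᴴ) := by
  ext x y
  have hL : (U * diagPadAt N M r c k A * Wᴴ) x y =
      ∑ p, ∑ q, U x (e₁ p) * diagPadAt N M r c k A (e₁ p) (e₂ q) * star (W y (e₂ q)) := by
    rw [Matrix.mul_assoc, Matrix.mul_apply]
    symm
    refine Fintype.sum_of_injective e₁ he₁' _ _ (fun s hs => ?_) fun p => ?_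
    · rw [Matrix.mul_apply, Finset.sum_eq_zero, mul_zero]
      intro t _
      rw [diagPadAt_eq_zero_of_row he₁ A hs, zero_mul]
    · rw [Matrix.mul_apply, Finset.mul_sum]
      refine Fintype.sum_of_injective e₂ he₂' _ _ (fun t ht => ?_) fun q => ?_
      · rw [diagPadAt_eq_zero_of_col he₂ A _ ht, zero_mul, mul_zero]
      · rw [conjTranspose_apply, mul_assoc]
  rw [hL]
  simp only [Fintype.sum_prod_type, diagPadAt_apply_block he₁ he₂, Matrix.sum_apply,
    Matrix.smul_apply, Matrix.mul_apply, conjTranspose_apply, submatrix_apply, id, smul_eq_mul,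
    mul_ite, ite_mul, mul_zero, zero_mul, Finset.mul_sum]
  rw [Finset.sum_comm]
  refine Finset.sum_congr rfl fun i _ => ?_
  rw [Finset.sum_comm (s := Finset.univ (α := Fin m))]
  refine Finset.sum_congr rfl fun b _ => ?_
  rw [Finset.sum_comm]
  refine Finset.sum_congr rfl fun j _ => ?_
  rw [Finset.sum_ite_eq, if_pos (Finset.mem_univ b)]
  ring

end DiagPad

/-- The lexicographic embedding of the block index set of `diag_a ⊕ diag_b` into `Fin M`. -/
def blockEmbedding {a b m n M : ℕ} (h : a * m + b * n ≤ M) :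
    (Fin a × Fin m) ⊕ (Fin b × Fin n) → Fin M :=
  fun x => Fin.castLE h (finSumFinEquiv (Sum.map finProdFinEquiv finProdFinEquiv x))

section BlockEmbedding

variable {a b m n M : ℕ} (h : a * m + b * n ≤ M)

theorem blockEmbedding_injective : Function.Injective (blockEmbedding h) :=
  (Fin.castLE_injective h).comp <| finSumFinEquiv.injective.comp <|
    finProdFinEquiv.injective.sumMap finProdFinEquiv.injective

theorem blockEmbedding_inl (p : Fin a × Fin m) :
    (blockEmbedding h (Sum.inl p) : ℕ) = 0 + (p.2 + m * p.1) := by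
  simp [blockEmbedding]

theorem blockEmbedding_inr (p : Fin b × Fin n) :
    (blockEmbedding h (Sum.inr p) : ℕ) = a * m + (p.2 + n * p.1) := by
  simp [blockEmbedding]

end BlockEmbedding

/-- Mutually orthogonal families of isometries are blocks of a unitary matrix. -/
theorem exists_unitary_of_orthogonal_isometries {a b m n M : ℕ}
    {G : Fin m → Matrix (Fin M) (Fin a) ℂ} {H : Fin n → Matrix (Fin M) (Fin b) ℂ}
    (hG : ∀ i k, (G i)ᴴ * G k = if i = k then 1 else 0)
    (hH : ∀ i k, (H i)ᴴ * H k = if i = k then 1 else 0)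
    (hGH : ∀ i k, (G i)ᴴ * H k = 0) :
    ∃ h : a * m + b * n ≤ M, ∃ U ∈ Matrix.unitaryGroup (Fin M) ℂ,
      (∀ i, U.submatrix id (fun c => blockEmbedding h (Sum.inl (c, i))) = G i) ∧
      ∀ i, U.submatrix id (fun c => blockEmbedding h (Sum.inr (c, i))) = H i := by
  let T : Matrix (Fin M) ((Fin a × Fin m) ⊕ (Fin b × Fin n)) ℂ :=
    Matrix.of fun x => Sum.elim (fun p => G p.2 x p.1) (fun p => H p.2 x p.1)
  have hHG : ∀ i k, (H i)ᴴ * G k = 0 := fun i k => by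
    simpa using congrArg conjTranspose (hGH k i)
  have hT : Tᴴ * T = 1 := by
    ext p q
    rcases p with ⟨c, i⟩ | ⟨c, i⟩ <;> rcases q with ⟨d, j⟩ | ⟨d, j⟩
    · have := congrFun (congrFun (hG i j) c) d
      by_cases hij : i = j <;> by_cases hcd : c = d <;>
        simpa [Matrix.mul_apply, T, hij, hcd, Matrix.one_apply] using this
    · simpa [Matrix.mul_apply, T] using congrFun (congrFun (hGH i j) c) d
    · simpa [Matrix.mul_apply, T] using congrFun (congrFun (hHG i j) c) d
    · have := congrFun (congrFun (hH i j) c) d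
      by_cases hij : i = j <;> by_cases hcd : c = d <;>
        simpa [Matrix.mul_apply, T, hij, hcd, Matrix.one_apply] using this
  have h : a * m + b * n ≤ M := by simpa using card_le_of_conjTranspose_mul_self hT
  obtain ⟨U, hU, hUT⟩ := exists_unitary_extension_s2 hT (blockEmbedding_injective h)
  refine ⟨h, U, hU, fun i => ?_, fun i => ?_⟩ <;> ext x c <;> simp [hUT, T]

theorem isTripleGrid_of_tripleMorphism {m n M N : ℕ}
    (φ : Matrix (Fin m) (Fin n) ℂ →ₗ[ℂ] Matrix (Fin M) (Fin N) ℂ)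
    (hφ : ∀ x y z : Matrix (Fin m) (Fin n) ℂ,
      φ ((1/2 : ℂ) • (x * yᴴ * z + z * yᴴ * x)) =
        (1/2 : ℂ) • (φ x * (φ y)ᴴ * φ z + φ z * (φ y)ᴴ * φ x)) :
    IsTripleGrid fun i j => φ (Matrix.single i j 1) := by
  intro i j k l p q
  have h := hφ (single i j 1) (single k l 1) (single p q 1)
  rw [map_smul] at h
  have h' := smul_right_injective _ (by norm_num : (1/2 : ℂ) ≠ 0) h
  simp only at h' ⊢
  rw [← h', map_add, conjTranspose_single]
  congr 1
  · by_cases h1 : j = l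
    · subst h1
      by_cases h2 : k = p
      · subst h2; simp
      · simp [h2]
    · simp [h1]
  · by_cases h1 : q = l
    · subst h1
      by_cases h2 : k = i
      · subst h2; simp
      · simp [h2]
    · simp [h1]

/-- a Jordan triple morphism `M_{m,n}(ℂ) → M_{M,N}(ℂ)` is, up to
unitaries, given by `A ↦ diag_α(A) ⊕ diag_β(Aᵀ) ⊕ 0`. -/
theorem triple_morphism_rectangular_to_rectangular (m n M N : ℕ)
    (hm : 2 ≤ m) (hn : 2 ≤ n)
    (φ : Matrix (Fin m) (Fin n) ℂ →ₗ[ℂ] Matrix (Fin M) (Fin N) ℂ)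
    (hφ : ∀ x y z : Matrix (Fin m) (Fin n) ℂ,
      φ ((1/2 : ℂ) • (x * yᴴ * z + z * yᴴ * x)) =
        (1/2 : ℂ) • (φ x * (φ y)ᴴ * φ z + φ z * (φ y)ᴴ * φ x)) :
    ∃ α β : ℕ, α * m + β * n ≤ M ∧ α * n + β * m ≤ N ∧
      ∃ U ∈ Matrix.unitaryGroup (Fin M) ℂ, ∃ V ∈ Matrix.unitaryGroup (Fin N) ℂ,
        ∀ A : Matrix (Fin m) (Fin n) ℂ,
          φ A = U * (diagPadAt M N 0 0 α A + diagPadAt M N (α * m) (α * n) β Aᵀ) * V := by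
  have : Nontrivial (Fin m) := Fin.nontrivial_iff_two_le.2 hm
  have : Nontrivial (Fin n) := Fin.nontrivial_iff_two_le.2 hn
  obtain ⟨a, b, ha, hb, hab, horth, horth'⟩ :=
    (isTripleGrid_of_tripleMorphism φ hφ).exists_decomposition
  obtain ⟨α, G, F, hG, hF, haGF⟩ := ha.exists_factorization
  obtain ⟨β, G', F', hG', hF', hbGF⟩ := hb.exists_factorization
  obtain ⟨i₀, -⟩ := exists_pair_ne (Fin m)
  obtain ⟨j₀, -⟩ := exists_pair_ne (Fin n)
  have hGa : ∀ i, G i = a i j₀ * F j₀ := fun i => by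
    rw [haGF, Matrix.mul_assoc, hF, if_pos rfl, Matrix.mul_one]
  have hGb : ∀ j, G' j = b j i₀ * F' i₀ := fun j => by
    rw [hbGF, Matrix.mul_assoc, hF', if_pos rfl, Matrix.mul_one]
  have hFa : ∀ j, F j = (a i₀ j)ᴴ * G i₀ := fun j => by
    rw [haGF, conjTranspose_mul, conjTranspose_conjTranspose, Matrix.mul_assoc, hG, if_pos rfl,
      Matrix.mul_one]
  have hFb : ∀ i, F' i = (b j₀ i)ᴴ * G' j₀ := fun i => by
    rw [hbGF, conjTranspose_mul, conjTranspose_conjTranspose, Matrix.mul_assoc, hG', if_pos rfl,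
      Matrix.mul_one]
  have hGG : ∀ i j, (G i)ᴴ * G' j = 0 := fun i j => by
    rw [hGa, hGb, conjTranspose_mul, Matrix.mul_assoc, ← Matrix.mul_assoc (a i j₀)ᴴ, horth']
    simp
  have hFF : ∀ j i, (F j)ᴴ * F' i = 0 := fun j i => by
    rw [hFa, hFb, conjTranspose_mul, conjTranspose_conjTranspose, Matrix.mul_assoc,
      ← Matrix.mul_assoc (a i₀ j), horth]
    simp
  obtain ⟨h₁, U, hU, hUG, hUG'⟩ := exists_unitary_of_orthogonal_isometries hG hG' hGG
  obtain ⟨h₂, W, hW, hWF, hWF'⟩ := exists_unitary_of_orthogonal_isometries hF hF' hFF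
  refine ⟨α, β, h₁, h₂, U, hU, Wᴴ, Unitary.star_mem hW, fun A => ?_⟩
  have inj₁ := blockEmbedding_injective h₁
  have inj₂ := blockEmbedding_injective h₂
  rw [Matrix.mul_add, Matrix.add_mul,
    mul_diagPadAt_mul_conjTranspose (blockEmbedding_inl h₁) (inj₁.comp Sum.inl_injective)
      (blockEmbedding_inl h₂) (inj₂.comp Sum.inl_injective),
    mul_diagPadAt_mul_conjTranspose (blockEmbedding_inr h₁) (inj₁.comp Sum.inr_injective)
      (blockEmbedding_inr h₂) (inj₂.comp Sum.inr_injective)]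
  simp only [hUG, hUG', hWF, hWF', ← haGF, ← hbGF, transpose_apply]
  rw [Finset.sum_comm (f := fun i j => A j i • b i j)]
  conv_lhs => rw [matrix_eq_sum_single A]
  simp only [map_sum, ← Finset.sum_add_distrib, ← smul_add, ← hab, ← map_smul, smul_single,
    smul_eq_mul, mul_one]
end

section
/- Let n ≥ 2 and let φ : {A ∈ M_n(ℂ) : Aᵀ = A} → {B ∈ M_N(ℂ) : Bᵀ = B} be a triple morphism between the spaces of symmetric complex matrices. Then there exist a natural number α with α·n ≤ N and unitary matrices U, V ∈ M_N(ℂ) such that φ(A) = U · (diag_α(A) ⊕ 0) · V for every symmetric A ∈ M_n(ℂ), where diag_α(A) ⊕ 0 is the N×N matrix with diag_α(A) as its top-left corner block and zeros elsewhere. -/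
open Matrix

/-- The subspace of symmetric complex `n × n` matrices. -/
noncomputable def symmSub (n : ℕ) : Submodule ℂ (Matrix (Fin n) (Fin n) ℂ) where
  carrier := {A | Aᵀ = A}
  add_mem' := by
    intro a b ha hb
    simp only [Set.mem_setOf_eq] at *
    rw [Matrix.transpose_add, ha, hb]
  zero_mem' := by simp
  smul_mem' := by
    intro c A hA
    simp only [Set.mem_setOf_eq] at *
    rw [Matrix.transpose_smul, hA]

section StarRing

variable {R : Type*} [Ring R] [Algebra ℂ R]

theorem mul_eq_zero_of_anticomm_idempotent {p s : R} (hp : p * p = p)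
    (h : p * s + s * p = 0) : p * s = 0 := by
  have h1 : p * s + p * s * p = 0 := by
    have := congrArg (p * ·) h
    simpa [mul_add, ← mul_assoc, hp] using this
  have h2 : p * s * p + s * p = 0 := by
    have := congrArg (· * p) h
    simpa [add_mul, mul_assoc, hp] using this
  have h3 : p * s = s * p := by
    rw [eq_neg_of_add_eq_zero_left h1, eq_neg_of_add_eq_zero_right h2]
  rw [← h3] at h
  have h4 : (2 : ℂ) • (p * s) = 0 := by rw [two_smul, h]
  simpa using h4

theorem eq_mul_of_mul_add_mul_eq_two {p q x : R} (hp : p * p = p) (hq : q * q = q)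
    (h : p * x + x * q = x + x) : p * x = x ∧ x * q = x := by
  have h1 : p * x * q = p * x := by
    have := congrArg (p * ·) h
    simp only [mul_add, ← mul_assoc, hp] at this
    exact add_left_cancel this
  have h2 : p * x * q = x * q := by
    have := congrArg (· * q) h
    simp only [add_mul] at this
    rw [mul_assoc x q q, hq] at this
    exact add_right_cancel this
  have h3 : p * x = x * q := h1.symm.trans h2
  have h4 : p * x = x := by
    rw [← h3, ← two_smul ℂ, ← two_smul ℂ x] at h
    exact smul_right_injective R (two_ne_zero (α := ℂ)) h
  exact ⟨h4, h3 ▸ h4⟩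

variable [StarRing R] [StarModule ℂ R] {ι : Type*} [DecidableEq ι]

/-- A family satisfying the Jordan multiplication table of the symmetrized matrix units
`E i j + E j i` comes from the first column of a system of matrix units. -/
theorem exists_column_of_symm_units (s : ι → ι → R)
    (hstar : ∀ i j, star (s i j) = s i j)
    (hcomm : ∀ i j, s i j = s j i)
    (hmul : ∀ i j k l, s i j * s k l + s k l * s i j =
      (if j = k then s i l else 0) + (if j = l then s i k else 0) +
      (if i = k then s j l else 0) + (if i = l then s j k else 0)) (o : ι) :
    ∃ (p : R) (f : ι → R), p * p = p ∧ star p = p ∧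
      (∀ i, f i * p = f i) ∧
      (∀ i j, star (f i) * f j = if i = j then p else 0) ∧
      (∀ i j, f i * star (f j) + f j * star (f i) = s i j) := by
  set p : ι → R := fun i => (1/2 : ℂ) • s i i with hp
  have hs : ∀ i, s i i = p i + p i := by
    intro i
    rw [← two_smul ℂ, hp, smul_smul]; norm_num
  have hpp : ∀ i, p i * p i = p i := by
    intro i
    have h := hmul i i i i
    simp only [if_true] at h
    simp only [hp, smul_mul_smul_comm]
    have h' : s i i * s i i = (2 : ℂ) • s i i := by
      have : (2 : ℂ) • (s i i * s i i) = (2 : ℂ) • ((2 : ℂ) • s i i) := by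
        rw [two_smul, h, smul_smul]
        module
      exact smul_right_injective R (two_ne_zero (α := ℂ)) this
    rw [h', smul_smul]; norm_num
  have hpstar : ∀ i, star (p i) = p i := by
    intro i
    simp [hp, hstar]
  have hps : ∀ i j, i ≠ j → p i * s i j + s i j * p i = s i j := by
    intro i j hij
    have h := hmul i i i j
    simp only [if_true, if_neg hij, add_zero] at h
    simp only [hp, smul_mul_assoc, mul_smul_comm, ← smul_add, h]
    rw [← two_smul ℂ, smul_smul]; norm_num
  have hps' : ∀ i j, i ≠ j → p j * s i j + s i j * p j = s i j := by
    intro i j hij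
    rw [hcomm i j]
    exact hps j i hij.symm
  have hps0 : ∀ i j k, i ≠ j → i ≠ k → p i * s j k = 0 := by
    intro i j k hij hik
    apply mul_eq_zero_of_anticomm_idempotent (hpp i)
    have h := hmul i i j k
    simp only [if_neg hij, if_neg hik, add_zero] at h
    simp only [hp, smul_mul_assoc, mul_smul_comm, ← smul_add, h, smul_zero]
  have hpp0 : ∀ i j, i ≠ j → p i * p j = 0 := by
    intro i j hij
    have h := hps0 i j j hij hij
    simp only [hp] at h ⊢
    rw [mul_smul_comm, h, smul_zero]
  have hsp : ∀ i j, i ≠ j → p i * s i j = s i j * p j := by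
    intro i j hij
    have h1 := congrArg (p i * ·) (hps' i j hij)
    have h2 := congrArg (· * p j) (hps i j hij)
    simp only [mul_add, add_mul, ← mul_assoc, hpp0 i j hij, zero_mul, zero_add] at h1 h2
    rw [mul_assoc (s i j), hpp0 i j hij, mul_zero, add_zero] at h2
    exact h1.symm.trans h2
  have hss : ∀ i j, i ≠ j → s i j * s i j = p i + p j := by
    intro i j hij
    have h := hmul i j i j
    simp only [if_true, if_neg hij, if_neg hij.symm, add_zero, zero_add, hs] at h
    have : (2 : ℂ) • (s i j * s i j) = (2 : ℂ) • (p i + p j) := by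
      rw [two_smul, h]; module
    exact smul_right_injective R (two_ne_zero (α := ℂ)) this
  have hsss : ∀ i j k, i ≠ j → j ≠ k → i ≠ k → s i j * s j k + s j k * s i j = s i k := by
    intro i j k hij hjk hik
    simpa [hij, hjk, hik] using hmul i j j k
  have hpsp : ∀ i j, i ≠ j → p i * s i j * p i = 0 := by
    intro i j hij
    rw [hsp i j hij, mul_assoc, hpp0 j i hij.symm, mul_zero]
  have hfstar : ∀ i, star (s i o * p o) = p o * s i o := by
    intro i
    rw [star_mul, hstar, hpstar]
  refine ⟨p o, fun i => if i = o then p o else s i o * p o, hpp o, hpstar o, ?_, ?_, ?_⟩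
  · intro i
    by_cases hi : i = o
    · simp [hi, hpp]
    · simp [hi, mul_assoc, hpp]
  · intro i j
    by_cases hi : i = o <;> by_cases hj : j = o
    · subst hi; subst hj
      simp [hpstar, hpp]
    · subst hi
      simp only [if_true, if_neg hj, if_neg (Ne.symm hj), hpstar]
      rw [hcomm, ← mul_assoc, hpsp _ _ (Ne.symm hj)]
    · subst hj
      simp only [if_true, if_neg hi, hfstar]
      rw [hcomm, hpsp _ _ (Ne.symm hi)]
    · simp only [if_neg hi, if_neg hj, hfstar]
      by_cases hij : i = j
      · subst hij
        rw [if_pos rfl, mul_assoc, ← mul_assoc (s i o), hss _ _ hi, add_mul, mul_add,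
          hpp, hpp, hpp0 _ _ hi, mul_zero, zero_add]
      · rw [if_neg hij, hcomm i o, hsp _ _ (Ne.symm hi), mul_assoc, ← mul_assoc (p i),
          hps0 _ _ _ hij hi, zero_mul, mul_zero]
  · intro i j
    by_cases hi : i = o <;> by_cases hj : j = o
    · subst hi; subst hj
      simp [hpstar, hpp, hs]
    · subst hi
      simp only [if_true, if_neg hj, hpstar, hfstar]
      rw [← mul_assoc, hpp, mul_assoc, hpp, hcomm j i]
      exact hps _ _ (Ne.symm hj)
    · subst hj
      simp only [if_true, if_neg hi, hpstar, hfstar]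
      rw [← mul_assoc, hpp, mul_assoc, hpp, add_comm]
      exact hps' _ _ hi
    · simp only [if_neg hi, if_neg hj, hfstar]
      have e : ∀ i j, s i o * p o * (p o * s j o) = s i o * p o * s j o := by
        intro i j
        rw [mul_assoc, ← mul_assoc (p o), hpp, ← mul_assoc]
      rw [e, e]
      by_cases hij : i = j
      · subst hij
        rw [← hsp _ _ hi, mul_assoc, hss _ _ hi, mul_add, hpp, hpp0 _ _ hi, add_zero, hs]
      · have h : ∀ i j, i ≠ o → j ≠ o → i ≠ j → s i o * p o * s j o = p i * s i j := by
          intro i j hi hj hij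
          rw [← hsp _ _ hi, ← hsss i o j hi (Ne.symm hj) hij, mul_add, ← mul_assoc (p i) (s o j),
            hps0 _ _ _ hi hij, zero_mul, add_zero, mul_assoc, hcomm o j]
        rw [h i j hi hj hij, h j i hj hi (Ne.symm hij), hcomm j i]
        have := hps' i j hij
        rw [← hsp i j hij] at this
        rw [add_comm, this]

end StarRing

section Isometry

theorem exists_isometry_of_projection {N : ℕ} (p : Matrix (Fin N) (Fin N) ℂ)
    (hp : p * p = p) (hs : pᴴ = p) :
    ∃ (k : ℕ) (v : Matrix (Fin N) (Fin k) ℂ), vᴴ * v = 1 ∧ v * vᴴ = p := by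
  classical
  have hH : p.IsHermitian := hs
  set u : Matrix (Fin N) (Fin N) ℂ := (hH.eigenvectorUnitary : Matrix (Fin N) (Fin N) ℂ) with hu
  set d : Fin N → ℂ := fun i => (hH.eigenvalues i : ℂ) with hd
  have hu1 : uᴴ * u = 1 := by
    have := hH.eigenvectorUnitary.2
    exact (mem_unitaryGroup_iff'.1 this)
  have hspec : p = u * diagonal d * uᴴ := by
    have := hH.spectral_theorem
    rw [Unitary.conjStarAlgAut_apply] at this
    exact this
  have hdd : diagonal d * diagonal d = diagonal d := by
    have h : uᴴ * p * u = diagonal d := by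
      rw [hspec]
      simp only [Matrix.mul_assoc, hu1, Matrix.mul_one]
      rw [← Matrix.mul_assoc, hu1, Matrix.one_mul]
    have hu2 : u * uᴴ = 1 := mul_eq_one_comm.1 hu1
    calc diagonal d * diagonal d = uᴴ * p * (u * uᴴ) * p * u := by
          rw [← h]; simp only [Matrix.mul_assoc]
      _ = uᴴ * (p * p) * u := by rw [hu2]; simp only [Matrix.mul_assoc, Matrix.one_mul]
      _ = diagonal d := by rw [hp, h]
  have hd01 : ∀ i, d i = 0 ∨ d i = 1 := by
    intro i
    rw [diagonal_mul_diagonal] at hdd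
    have := congrFun (diagonal_injective hdd) i
    have h2 : d i * (d i - 1) = 0 := by linear_combination this
    rcases mul_eq_zero.1 h2 with h | h
    · exact Or.inl h
    · exact Or.inr (sub_eq_zero.1 h)
  let c := Fintype.equivFin {i : Fin N // d i = 1}
  refine ⟨_, u.submatrix id (fun a => (c.symm a).1), ?_, ?_⟩
  · ext a b
    have := congrFun (congrFun hu1 (c.symm a).1) (c.symm b).1
    simp only [mul_apply, conjTranspose_apply, submatrix_apply, id] at this ⊢
    rw [this, one_apply, one_apply]
    simp [Subtype.val_injective.eq_iff]
  · rw [hspec]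
    ext a b
    rw [mul_apply, mul_apply]
    simp only [conjTranspose_apply, submatrix_apply, id, mul_diagonal]
    rw [Equiv.sum_comp c.symm (fun x => u a x.1 * star (u b x.1)),
      ← Finset.sum_subtype (Finset.univ.filter fun i => d i = 1) (by simp)
        (fun x => u a x * star (u b x)), Finset.sum_filter]
    refine Finset.sum_congr rfl fun i _ => ?_
    rcases hd01 i with h | h <;> simp [h]

theorem card_le_of_isometry {N : ℕ} {ι : Type*} [Fintype ι] [DecidableEq ι]
    (X : Matrix (Fin N) ι ℂ) (hX : Xᴴ * X = 1) : Fintype.card ι ≤ N := by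
  have h1 : (Xᴴ * X).rank ≤ X.rank := rank_mul_le_right _ _
  rw [hX, rank_one] at h1
  simpa using h1.trans (rank_le_card_height X)

theorem exists_unitary_extension {N : ℕ} {ι : Type*} [Fintype ι] [DecidableEq ι]
    (X : Matrix (Fin N) ι ℂ) (hX : Xᴴ * X = 1) (g : ι ↪ Fin N) :
    ∃ U ∈ unitaryGroup (Fin N) ℂ, U.submatrix id g = X := by
  classical
  let w : Fin N → EuclideanSpace ℂ (Fin N) := fun k =>
    if h : ∃ x, g x = k then WithLp.toLp 2 (fun r => X r h.choose) else 0
  have hw : ∀ x, w (g x) = WithLp.toLp 2 (fun r => X r x) := by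
    intro x
    have h : ∃ y, g y = g x := ⟨x, rfl⟩
    simp only [w, dif_pos h, g.injective h.choose_spec]
  have ho : Orthonormal ℂ ((Set.range g).domRestrict w) := by
    rw [orthonormal_iff_ite]
    rintro ⟨k, hk⟩ ⟨l, hl⟩
    obtain ⟨x, rfl⟩ := Set.mem_range.1 hk
    obtain ⟨y, rfl⟩ := Set.mem_range.1 hl
    have := congrFun (congrFun hX x) y
    change inner ℂ (w (g x)) (w (g y)) = _
    simp only [hw, Subtype.mk.injEq, g.injective.eq_iff]
    rw [one_apply, mul_apply] at this
    rw [← this]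
    simp [PiLp.inner_apply, mul_comm]
  obtain ⟨b, hb⟩ := ho.exists_orthonormalBasis_extension_of_card_eq (by simp)
  refine ⟨of fun r k => b k r, ?_, ?_⟩
  · rw [mem_unitaryGroup_iff']
    ext k l
    have := orthonormal_iff_ite.1 b.orthonormal k l
    rw [star_eq_conjTranspose, mul_apply, one_apply, ← this]
    simp [PiLp.inner_apply, mul_comm]
  · ext r x
    simp [hb (g x) ⟨x, rfl⟩, hw]

end Isometry

section DiagPad

/-- The position of the `i`-th coordinate of the `a`-th block. -/
def blockEmb {k n N : ℕ} (h : k * n ≤ N) : Fin k × Fin n ↪ Fin N :=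
  finProdFinEquiv.toEmbedding.trans (Fin.castLEEmb h)

theorem diagPad_blockEmb {k n N M m : ℕ} (h : k * n ≤ N) (h' : k * m ≤ M)
    (A : Matrix (Fin n) (Fin m) ℂ) (x : Fin k × Fin n) (y : Fin k × Fin m) :
    diagPad N M k A (blockEmb h x) (blockEmb h' y) = if x.1 = y.1 then A x.2 y.2 else 0 := by
  obtain ⟨a, i⟩ := x
  obtain ⟨b, j⟩ := y
  have hi : (blockEmb h (a, i) : ℕ) = i + n * a := rfl
  have hj : (blockEmb h' (b, j) : ℕ) = j + m * b := rfl
  have hn : 0 < n := i.pos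
  have hm : 0 < m := j.pos
  have hi1 : ((i : ℕ) + n * a) % n = i := by simp [Nat.mod_eq_of_lt i.2]
  have hj1 : ((j : ℕ) + m * b) % m = j := by simp [Nat.mod_eq_of_lt j.2]
  have hi2 : ((i : ℕ) + n * a) / n = a := by
    rw [Nat.add_mul_div_left _ _ hn, Nat.div_eq_of_lt i.2, zero_add]
  have hj2 : ((j : ℕ) + m * b) / m = b := by
    rw [Nat.add_mul_div_left _ _ hm, Nat.div_eq_of_lt j.2, zero_add]
  have hi3 : (i : ℕ) + n * a < k * n := (finProdFinEquiv (a, i)).2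
  have hj3 : (j : ℕ) + m * b < k * m := (finProdFinEquiv (b, j)).2
  simp only [diagPad, of_apply, hi, hj, hi1, hj1, hi2, hj2, hi3, hj3, i.2, j.2, true_and,
    Fin.val_inj, Fin.eta]
  split_ifs <;> rfl

theorem diagPad_eq_zero {k n N M m : ℕ} (A : Matrix (Fin n) (Fin m) ℂ) (i : Fin N) (j : Fin M)
    (hij : ¬ ((i : ℕ) < k * n ∧ (j : ℕ) < k * m)) : diagPad N M k A i j = 0 := by
  rw [diagPad, of_apply, dif_neg]
  tauto

theorem mem_range_blockEmb {k n N : ℕ} (h : k * n ≤ N) (r : Fin N) (hr : (r : ℕ) < k * n) :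
    ∃ x, blockEmb h x = r :=
  ⟨finProdFinEquiv.symm ⟨r, hr⟩, by simp [blockEmb, Fin.ext_iff, Nat.mod_add_div]⟩

theorem mul_diagPad_mul {k n N : ℕ} (h : k * n ≤ N) (A : Matrix (Fin n) (Fin n) ℂ)
    (U V : Matrix (Fin N) (Fin N) ℂ) (r s : Fin N) :
    (U * diagPad N N k A * V) r s =
      ∑ i, ∑ j, A i j * ∑ a, U r (blockEmb h (a, i)) * V (blockEmb h (a, j)) s := by
  have e : (U * diagPad N N k A * V) r s =
      ∑ x, ∑ y, U r (blockEmb h x) * diagPad N N k A (blockEmb h x) (blockEmb h y) *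
        V (blockEmb h y) s := by
    simp only [mul_apply, Finset.sum_mul]
    rw [Finset.sum_comm]
    symm
    refine Finset.sum_of_injOn (blockEmb h) (blockEmb h).injective.injOn (by simp) ?_ ?_
    · intro i _ hi
      refine Finset.sum_eq_zero fun j _ => ?_
      rw [diagPad_eq_zero, mul_zero, zero_mul]
      rintro ⟨h1, -⟩
      obtain ⟨x, hx⟩ := mem_range_blockEmb h i h1
      exact hi ⟨x, by simp, hx⟩
    · intro x _
      refine Finset.sum_of_injOn (blockEmb h) (blockEmb h).injective.injOn (by simp) ?_ ?_
      · intro j _ hj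
        rw [diagPad_eq_zero, mul_zero, zero_mul]
        rintro ⟨-, h1⟩
        obtain ⟨y, hy⟩ := mem_range_blockEmb h j h1
        exact hj ⟨y, by simp, hy⟩
      · intro y _
        rfl
  rw [e]
  simp only [diagPad_blockEmb, Fintype.sum_prod_type, Finset.mul_sum]
  rw [Finset.sum_comm]
  refine Finset.sum_congr rfl fun i _ => ?_
  conv_rhs => rw [Finset.sum_comm]
  refine Finset.sum_congr rfl fun a _ => ?_
  rw [Finset.sum_comm]
  refine Finset.sum_congr rfl fun j _ => ?_
  simp only [mul_ite, ite_mul, mul_zero, zero_mul, Finset.sum_ite_eq, Finset.mem_univ, if_true]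
  ring

end DiagPad

section Jordan

/-- The symmetrized matrix unit `E i j + E j i`. -/
noncomputable def symmUnit {n : ℕ} (i j : Fin n) : symmSub n :=
  ⟨single i j 1 + single j i 1, by
    change (single i j (1 : ℂ) + single j i 1)ᵀ = _
    rw [transpose_add, transpose_single, transpose_single, add_comm]⟩

theorem symmUnit_comm {n : ℕ} (i j : Fin n) : symmUnit i j = symmUnit j i :=
  Subtype.ext (add_comm _ _)

theorem symmSub_eq_sum {n : ℕ} (A : symmSub n) :
    A = (1/2 : ℂ) • ∑ i, ∑ j, A.1 i j • symmUnit i j := by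
  have hA : A.1ᵀ = A.1 := A.2
  have h1 : ∑ i, ∑ j, A.1 i j • single i j (1 : ℂ) = A.1 := by
    simpa [smul_single] using (matrix_eq_sum_single A.1).symm
  have h2 : ∑ i, ∑ j, A.1 i j • single j i (1 : ℂ) = A.1 := by
    rw [Finset.sum_comm]
    conv_rhs => rw [← h1]
    refine Finset.sum_congr rfl fun i _ => Finset.sum_congr rfl fun j _ => ?_
    rw [← transpose_apply A.1 i j, hA]
  apply Subtype.ext
  simp only [Submodule.coe_smul, AddSubmonoidClass.coe_finsetSum, symmUnit, smul_add,
    Finset.sum_add_distrib, h1, h2]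
  module

theorem symmUnit_mul {n : ℕ} (i j k l : Fin n) :
    (symmUnit i j).1 * (symmUnit k l).1 + (symmUnit k l).1 * (symmUnit i j).1 =
      ((if j = k then symmUnit i l else 0) + (if j = l then symmUnit i k else 0) +
      (if i = k then symmUnit j l else 0) + (if i = l then symmUnit j k else 0) : symmSub n).1 := by
  have hs : ∀ a b c d : Fin n, single a b (1 : ℂ) * single c d 1 =
      if b = c then single a d 1 else 0 := by
    intro a b c d
    split_ifs with h
    · subst h; simp
    · exact single_mul_single_of_ne _ _ _ _ h _
  have hv : ∀ (P : Prop) [Decidable P] (x : symmSub n),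
      ((if P then x else 0 : symmSub n) : Matrix (Fin n) (Fin n) ℂ) = if P then x.1 else 0 := by
    intro P _ x
    split_ifs <;> rfl
  simp only [Submodule.coe_add, hv]
  simp only [symmUnit, add_mul, mul_add, hs, @eq_comm _ k, @eq_comm _ l]
  split_ifs <;> abel

theorem exists_column_of_jordan_hom {n N : ℕ} (ψ : symmSub n →ₗ[ℂ] Matrix (Fin N) (Fin N) ℂ)
    (hmul : ∀ x y w : symmSub n, w.1 = x.1 * y.1 + y.1 * x.1 → ψ w = ψ x * ψ y + ψ y * ψ x)
    (hstar : ∀ x y : symmSub n, y.1 = x.1ᴴ → ψ y = (ψ x)ᴴ) (o : Fin n) :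
    ∃ (p : Matrix (Fin N) (Fin N) ℂ) (f : Fin n → Matrix (Fin N) (Fin N) ℂ),
      p * p = p ∧ pᴴ = p ∧ (∀ i, f i * p = f i) ∧
      (∀ i j, (f i)ᴴ * f j = if i = j then p else 0) ∧
      (∀ A, ψ A = ∑ i, ∑ j, A.1 i j • (f i * (f j)ᴴ)) := by
  obtain ⟨p, f, h1, h2, h4, h5, h6⟩ := exists_column_of_symm_units
    (fun i j => ψ (symmUnit i j))
    (fun i j => (hstar _ _ (by
      simp [symmUnit, conjTranspose_add, conjTranspose_single, add_comm])).symm)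
    (fun i j => by simp only [symmUnit_comm i j])
    (fun i j k l => by
      have := (hmul _ _ _ (symmUnit_mul i j k l).symm).symm
      simp only [map_add, apply_ite ψ, map_zero] at this
      exact this) o
  refine ⟨p, f, h1, h2, h4, h5, fun A => ?_⟩
  have hA : A.1ᵀ = A.1 := A.2
  have h7 : ∑ i, ∑ j, A.1 i j • (f j * (f i)ᴴ) = ∑ i, ∑ j, A.1 i j • (f i * (f j)ᴴ) := by
    rw [Finset.sum_comm]
    refine Finset.sum_congr rfl fun i _ => Finset.sum_congr rfl fun j _ => ?_
    rw [← transpose_apply A.1 i j, hA]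
  conv_lhs => rw [symmSub_eq_sum A]
  simp only [map_smul, map_sum]
  simp only [← h6, smul_add, Finset.sum_add_distrib, star_eq_conjTranspose, h7]
  module

end Jordan

/-- a triple morphism between symmetric matrix spaces is, up to
unitaries, a multiple of the identity representation. -/
theorem triple_morphism_symm_to_symm (n N : ℕ) (hn : 2 ≤ n)
    (φ : symmSub n →ₗ[ℂ] symmSub N)
    (hφ : ∀ x y z w : symmSub n,
      (w : Matrix (Fin n) (Fin n) ℂ) =
        (1/2 : ℂ) • ((x : Matrix (Fin n) (Fin n) ℂ) * (y : Matrix (Fin n) (Fin n) ℂ)ᴴ *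
            (z : Matrix (Fin n) (Fin n) ℂ) +
          (z : Matrix (Fin n) (Fin n) ℂ) * (y : Matrix (Fin n) (Fin n) ℂ)ᴴ *
            (x : Matrix (Fin n) (Fin n) ℂ)) →
      (φ w : Matrix (Fin N) (Fin N) ℂ) =
        (1/2 : ℂ) • ((φ x : Matrix (Fin N) (Fin N) ℂ) * (φ y : Matrix (Fin N) (Fin N) ℂ)ᴴ *
            (φ z : Matrix (Fin N) (Fin N) ℂ) +
          (φ z : Matrix (Fin N) (Fin N) ℂ) * (φ y : Matrix (Fin N) (Fin N) ℂ)ᴴ *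
            (φ x : Matrix (Fin N) (Fin N) ℂ))) :
    ∃ α : ℕ, α * n ≤ N ∧
      ∃ U ∈ Matrix.unitaryGroup (Fin N) ℂ, ∃ V ∈ Matrix.unitaryGroup (Fin N) ℂ,
        ∀ A : symmSub n,
          (φ A : Matrix (Fin N) (Fin N) ℂ) =
            U * diagPad N N α (A : Matrix (Fin n) (Fin n) ℂ) * V := by
  set e := (φ ⟨1, transpose_one⟩ : Matrix (Fin N) (Fin N) ℂ) with he
  have h1 : e * eᴴ * e = e := by
    have := hφ ⟨1, transpose_one⟩ ⟨1, transpose_one⟩ ⟨1, transpose_one⟩ ⟨1, transpose_one⟩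
      (by simp only [conjTranspose_one, Matrix.mul_one]; module)
    rw [← he] at this
    exact (this.trans (by module)).symm
  have hpe : ∀ A : symmSub n, e * eᴴ * (φ A).1 = (φ A).1 ∧ (φ A).1 * (eᴴ * e) = (φ A).1 := by
    intro A
    apply eq_mul_of_mul_add_mul_eq_two
    · rw [← Matrix.mul_assoc, h1]
    · rw [← Matrix.mul_assoc, Matrix.mul_assoc eᴴ e, Matrix.mul_assoc, h1]
    · have := hφ ⟨1, transpose_one⟩ ⟨1, transpose_one⟩ A A
        (by simp only [conjTranspose_one, Matrix.mul_one, Matrix.one_mul]; module)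
      rw [← he, Matrix.mul_assoc (φ A).1] at this
      have h2 := congrArg ((2 : ℂ) • ·) this
      simp only [smul_smul] at h2
      rw [← two_smul ℂ (φ A).1, h2]
      module
  let ψ : symmSub n →ₗ[ℂ] Matrix (Fin N) (Fin N) ℂ :=
    (LinearMap.mulRight ℂ eᴴ) ∘ₗ (symmSub N).subtype ∘ₗ φ
  have hψ : ∀ A, ψ A = (φ A).1 * eᴴ := fun A => rfl
  have hφψ : ∀ A, (φ A).1 = ψ A * e := by
    intro A
    rw [hψ, Matrix.mul_assoc, (hpe A).2]
  have hmul : ∀ x y w : symmSub n, w.1 = x.1 * y.1 + y.1 * x.1 →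
      ψ w = ψ x * ψ y + ψ y * ψ x := by
    intro x y w hw
    have := hφ x ⟨1, transpose_one⟩ y ((1/2 : ℂ) • w) (by
      simp [hw])
    rw [← he, map_smul, Submodule.coe_smul] at this
    have h2 := smul_right_injective _ (by norm_num : (1/2 : ℂ) ≠ 0) this
    simp only [hψ, h2, add_mul, Matrix.mul_assoc]
  have hstar : ∀ x y : symmSub n, y.1 = x.1ᴴ → ψ y = (ψ x)ᴴ := by
    intro x y hy
    have := hφ ⟨1, transpose_one⟩ x ⟨1, transpose_one⟩ y (by
      simp only [hy, Matrix.mul_one, Matrix.one_mul]; module)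
    rw [← he] at this
    have h2 : (φ y).1 = e * (φ x).1ᴴ * e := by rw [this]; module
    rw [hψ, hψ, h2, conjTranspose_mul, conjTranspose_conjTranspose]
    conv_rhs => rw [← (hpe x).1]
    simp only [conjTranspose_mul, conjTranspose_conjTranspose, Matrix.mul_assoc]
  obtain ⟨p, f, hp, hps, hfp, hff, hsum⟩ := exists_column_of_jordan_hom ψ hmul hstar ⟨0, by omega⟩
  have hef : ∀ i, e * eᴴ * f i = f i := by
    intro i
    have hA : ∀ A, e * eᴴ * ψ A = ψ A := by
      intro A
      rw [hψ, ← Matrix.mul_assoc, (hpe A).1]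
    have hs : ψ ((1/2 : ℂ) • symmUnit i i) = f i * (f i)ᴴ := by
      rw [hsum]
      have h : ((1/2 : ℂ) • symmUnit i i : symmSub n).1 = single i i 1 := by
        simp only [Submodule.coe_smul, symmUnit]
        module
      simp only [h]
      simp [single_apply, ite_and]
    have h3 : f i * (f i)ᴴ * f i = f i := by
      rw [Matrix.mul_assoc, hff, if_pos rfl, hfp]
    rw [← h3, ← Matrix.mul_assoc, ← hs, hA]
  obtain ⟨α, v, hv1, hv2⟩ := exists_isometry_of_projection p hp hps
  let X : Matrix (Fin N) (Fin α × Fin n) ℂ := of fun r x => (f x.2 * v) r x.1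
  have hXe : e * eᴴ * X = X := by
    ext r x
    have h : e * eᴴ * (f x.2 * v) = f x.2 * v := by rw [← Matrix.mul_assoc, hef]
    have := Matrix.ext_iff.2 h r x.1
    rw [mul_apply] at this ⊢
    exact this
  have hXX : Xᴴ * X = 1 := by
    ext x y
    have h3 : (f x.2 * v)ᴴ * (f y.2 * v) = if x.2 = y.2 then 1 else 0 := by
      rw [conjTranspose_mul, Matrix.mul_assoc, ← Matrix.mul_assoc (f x.2)ᴴ, hff]
      split_ifs
      · rw [← hv2, Matrix.mul_assoc, hv1, Matrix.mul_one, hv1]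
      · simp
    have := Matrix.ext_iff.2 h3 x.1 y.1
    rw [mul_apply] at this ⊢
    refine this.trans ?_
    obtain ⟨a, i⟩ := x
    obtain ⟨b, j⟩ := y
    by_cases hij : i = j <;> simp [hij, one_apply]
  have hY : (eᴴ * X)ᴴ * (eᴴ * X) = 1 := by
    rw [conjTranspose_mul, conjTranspose_conjTranspose, Matrix.mul_assoc, ← Matrix.mul_assoc e,
      hXe, hXX]
  have hα : α * n ≤ N := by simpa using card_le_of_isometry X hXX
  obtain ⟨U, hU, hUX⟩ := exists_unitary_extension X hXX (blockEmb hα)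
  obtain ⟨W, hW, hWY⟩ := exists_unitary_extension (eᴴ * X) hY (blockEmb hα)
  refine ⟨α, hα, U, hU, star W, Unitary.star_mem hW, fun A => ?_⟩
  ext r s
  have hff' : ∀ i j, (f i * (f j)ᴴ * e) r s =
      ∑ a, U r (blockEmb hα (a, i)) * (star W) (blockEmb hα (a, j)) s := by
    intro i j
    have h4 : f i * (f j)ᴴ * e = (f i * v) * (eᴴ * (f j * v))ᴴ := by
      calc f i * (f j)ᴴ * e = f i * (v * vᴴ) * (f j)ᴴ * e := by rw [hv2, hfp]
        _ = _ := by
          simp only [conjTranspose_mul, conjTranspose_conjTranspose, Matrix.mul_assoc]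
    rw [h4, mul_apply]
    refine Finset.sum_congr rfl fun a _ => ?_
    have h5 := congrFun (congrFun hUX r) (a, i)
    have h6 := congrFun (congrFun hWY s) (a, j)
    simp only [submatrix_apply, id] at h5 h6
    rw [star_eq_conjTranspose, conjTranspose_apply, conjTranspose_apply, h5, h6]
    rfl
  rw [mul_diagPad_mul hα, hφψ, hsum]
  simp only [Finset.sum_mul, Matrix.sum_apply, Matrix.smul_mul, Matrix.smul_apply, hff',
    smul_eq_mul]
end

section
/- Let n ≥ 2 and let φ : {A ∈ M_n(ℂ) : Aᵀ = A} → M_{M,N}(ℂ) be a triple morphism from the symmetric complex n×n matrices to the rectangular M×N matrices. Then there exist a natural number α with α·n ≤ min{M,N} and unitary matrices U ∈ M_M(ℂ), V ∈ M_N(ℂ) such that φ(A) = U · (diag_α(A) ⊕ 0) · V for every symmetric A ∈ M_n(ℂ), where diag_α(A) ⊕ 0 is the M×N matrix with diag_α(A) as its top-left corner block and zeros elsewhere. -/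
open Matrix

theorem transpose_conjTranspose_of_transpose_eq {n : ℕ} {Y : Matrix (Fin n) (Fin n) ℂ}
    (hY : Yᵀ = Y) : (Yᴴ)ᵀ = Yᴴ := by
  rw [conjTranspose, hY, ← transpose_map, hY]

/-- A unital Jordan `*`-homomorphism on symmetric matrices, into a corner of a matrix algebra,
is given by matrix units, written here as `W i * (W j)ᴴ`. -/
theorem jordan_hom_exists_matrix_units {n N : ℕ} (o : Fin n)
    (π : Matrix (Fin n) (Fin n) ℂ →ₗ[ℂ] Matrix (Fin N) (Fin N) ℂ)
    (htriple : ∀ X Y Z : Matrix (Fin n) (Fin n) ℂ, Xᵀ = X → Yᵀ = Y → Zᵀ = Z →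
      π (X * Y * Z + Z * Y * X) = π X * π Y * π Z + π Z * π Y * π X)
    (hstar : ∀ X : Matrix (Fin n) (Fin n) ℂ, Xᵀ = X → π Xᴴ = (π X)ᴴ)
    (hl : ∀ X, π 1 * π X = π X) (hr : ∀ X, π X * π 1 = π X) :
    ∃ (p : Matrix (Fin N) (Fin N) ℂ) (W : Fin n → Matrix (Fin N) (Fin N) ℂ),
      p * p = p ∧ pᴴ = p ∧ (∀ i k, (W i)ᴴ * W k = if i = k then p else 0) ∧
      (∀ i, W i * p = W i) ∧ (∀ i, π 1 * W i = W i) ∧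
      ∀ A : Matrix (Fin n) (Fin n) ℂ, Aᵀ = A → π A = ∑ i, ∑ j, A i j • (W i * (W j)ᴴ) := by
  have half : ∀ {a b : Matrix (Fin N) (Fin N) ℂ}, a + a = b + b → a = b := by
    intro a b h
    rw [← two_smul ℂ a, ← two_smul ℂ b] at h
    exact smul_right_injective _ (two_ne_zero (α := ℂ)) h
  have hsand : ∀ X Y : Matrix (Fin n) (Fin n) ℂ, Xᵀ = X → Yᵀ = Y →
      π (X * Y * X) = π X * π Y * π X := by
    intro X Y hX hY
    have := htriple X Y X hX hY hX
    rw [map_add] at this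
    exact half this
  have hjordan : ∀ X Y : Matrix (Fin n) (Fin n) ℂ, Xᵀ = X → Yᵀ = Y →
      π (X * Y + Y * X) = π X * π Y + π Y * π X := by
    intro X Y hX hY
    simpa [hr] using htriple X 1 Y hX transpose_one hY
  let e : Fin n → Matrix (Fin n) (Fin n) ℂ := fun i => single i i 1
  have hee : ∀ i, e i * e i = e i := fun i => by simp [e]
  have hee0 : ∀ i j, i ≠ j → e i * e j = 0 := fun i j h => by simp [e, h]
  have heT : ∀ i, (e i)ᵀ = e i := fun i => by simp [e, transpose_single]
  have heH : ∀ i, (e i)ᴴ = e i := fun i => by simp [e, conjTranspose_single]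
  have hcomp : ∀ i j (A : Matrix (Fin n) (Fin n) ℂ), e i * A * e j = A i j • single i j 1 := by
    intro i j A
    simp [e, single_mul_mul_single]
  let p : Fin n → Matrix (Fin N) (Fin N) ℂ := fun i => π (e i)
  have hpp : ∀ i, p i * p i = p i := by
    intro i
    have := hjordan (e i) (e i) (heT i) (heT i)
    rw [hee, map_add] at this
    exact (half this).symm
  have hpp0 : ∀ i j, i ≠ j → p i * p j = 0 := by
    intro i j hij
    have h1 : p i * p j + p j * p i = 0 := by
      have := hjordan (e i) (e j) (heT i) (heT j)
      rw [hee0 i j hij, hee0 j i hij.symm] at this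
      simpa using this.symm
    have h2 : p i * p j * p i = 0 := by
      have := hsand (e i) (e j) (heT i) (heT j)
      rw [hee0 i j hij] at this
      simpa using this.symm
    have h3 : p i * (p i * p j + p j * p i) = p i * p j := by
      rw [mul_add, ← mul_assoc, ← mul_assoc, hpp, h2, add_zero]
    rw [← h3, h1, mul_zero]
  have hpH : ∀ i, (p i)ᴴ = p i := by
    intro i
    rw [← hstar (e i) (heT i), heH]
  have hsum : ∑ i, p i = π 1 := by
    rw [← map_sum]
    congr 1
    ext a b
    simp [e, Matrix.sum_apply, single_apply, one_apply, ite_and]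
  let J : Matrix (Fin n) (Fin n) ℂ := of fun _ _ => 1
  have hJT : Jᵀ = J := rfl
  have hJH : (π J)ᴴ = π J := by
    rw [← hstar J hJT]
    congr 1
    ext a b
    simp [J]
  have hJeJ : ∀ i, π J * p i * π J = π J := by
    intro i
    rw [← hsand J (e i) hJT (heT i)]
    congr 1
    ext a b
    simp [J, e, mul_apply, single_apply, ite_and]
  have hAij : ∀ A : Matrix (Fin n) (Fin n) ℂ, Aᵀ = A → ∀ i j,
      p i * π A * p j = A i j • (p i * π J * p j) := by
    intro A hA i j
    have key : ∀ B : Matrix (Fin n) (Fin n) ℂ, Bᵀ = B →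
        p i * π B * p j + p j * π B * p i = B i j • π (single i j 1 + single j i 1) := by
      intro B hB
      rw [← htriple (e i) B (e j) (heT i) hB (heT j), hcomp, hcomp,
        show B j i = B i j from congrFun (congrFun hB i) j, ← smul_add, map_smul]
    have h1 : p i * π A * p j + p j * π A * p i
        = A i j • (p i * π J * p j + p j * π J * p i) := by
      rw [key A hA, key J hJT]
      simp [J]
    rcases eq_or_ne i j with rfl | hij
    · rw [smul_add] at h1
      exact half h1
    · have h2 := congrArg (fun x => p i * x) h1
      simpa [mul_add, ← mul_assoc, hpp, hpp0 i j hij] using h2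
  refine ⟨p o, fun i => p i * π J * p o, hpp o, hpH o, ?_, ?_, ?_, ?_⟩
  · intro i k
    have h1 : (p i * π J * p o)ᴴ * (p k * π J * p o) = p o * π J * (p i * p k) * π J * p o := by
      simp only [conjTranspose_mul, hpH, hJH, mul_assoc]
    rw [h1]
    split_ifs with h
    · subst h
      have h2 : p o * π J * (p i * p i) * π J * p o = p o * (π J * p i * π J) * p o := by
        rw [hpp]
        simp only [mul_assoc]
      rw [h2, hJeJ, ← hsand (e o) J (heT o) hJT, hcomp]
      simp [J, p, e]
    · simp [hpp0 i k h]
  · intro i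
    rw [mul_assoc, hpp]
  · intro i
    rw [← mul_assoc, ← mul_assoc, hl]
  · intro A hA
    have h1 : ∀ i j, p i * π J * p o * (p j * π J * p o)ᴴ = p i * π J * p j := by
      intro i j
      have h2 : p i * π J * p o * (p j * π J * p o)ᴴ
          = p i * (π J * (p o * p o) * π J) * p j := by
        simp only [conjTranspose_mul, hpH, hJH, mul_assoc]
      rw [h2, hpp, hJeJ]
    simp only [h1, ← hAij A hA]
    calc π A = π 1 * π A * π 1 := by rw [hl, hr]
      _ = _ := by
        rw [← hsum, Finset.sum_mul, Finset.sum_mul]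
        simp only [Finset.mul_sum]

/-- A Hermitian idempotent matrix factors through an isometry. -/
theorem exists_isometry_of_isHermitian_idempotent {N : ℕ} (p : Matrix (Fin N) (Fin N) ℂ)
    (hp : p * p = p) (hpH : pᴴ = p) :
    ∃ (k : ℕ) (u : Matrix (Fin N) (Fin k) ℂ), uᴴ * u = 1 ∧ u * uᴴ = p := by
  let S := LinearMap.range (toEuclideanLin p)
  let b := stdOrthonormalBasis ℂ S
  let u : Matrix (Fin N) (Fin (Module.finrank ℂ S)) ℂ :=
    of fun i a => (b a : EuclideanSpace ℂ (Fin N)) i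
  have hu : uᴴ * u = 1 := by
    ext a c
    have h := orthonormal_iff_ite.mp b.orthonormal a c
    rw [Submodule.coe_inner, PiLp.inner_apply] at h
    simp only [mul_apply, conjTranspose_apply, u, of_apply, one_apply, ← h]
    exact Finset.sum_congr rfl fun i _ => by simp [mul_comm]
  have hpu : p * u = u := by
    ext i a
    obtain ⟨y, hy⟩ := (b a).2
    have h1 : toEuclideanLin p (b a : EuclideanSpace ℂ (Fin N)) = b a := by
      rw [← hy]
      ext j
      simp [toLpLin_apply, hp]
    have h2 := congrArg (fun x : EuclideanSpace ℂ (Fin N) => x i) h1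
    simpa [toLpLin_apply, mulVec, dotProduct, mul_apply, u] using h2
  have huup : u * uᴴ * p = p := by
    ext i j
    let x : S := ⟨toEuclideanLin p (EuclideanSpace.single j 1), LinearMap.mem_range_self _ _⟩
    have h1 := congrArg (fun y : S => (y : EuclideanSpace ℂ (Fin N)) i) (b.sum_repr' x)
    have hx : ∀ k, (x : EuclideanSpace ℂ (Fin N)) k = p k j := by
      intro k
      simp [x, toLpLin_apply]
    have hin : ∀ a, inner ℂ (b a) x = (uᴴ * p) a j := by
      intro a
      rw [Submodule.coe_inner, PiLp.inner_apply]
      simp only [mul_apply, conjTranspose_apply, u, of_apply, hx]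
      exact Finset.sum_congr rfl fun i _ => by simp [mul_comm]
    simp only [hin, hx] at h1
    rw [← h1, Matrix.mul_assoc, mul_apply]
    simp only [Submodule.coe_sum, WithLp.ofLp_sum, Finset.sum_apply, Submodule.coe_smul,
      PiLp.smul_apply, smul_eq_mul]
    exact Finset.sum_congr rfl fun a _ => mul_comm _ _
  refine ⟨_, u, hu, ?_⟩
  have h := congrArg conjTranspose huup
  simpa [conjTranspose_mul, hpH, ← Matrix.mul_assoc, hpu] using h

/-- The inclusion of the first `K` coordinates, as a matrix. -/
noncomputable def coordInclusion (M K : ℕ) : Matrix (Fin M) (Fin K) ℂ :=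
  of fun i k => if (i : ℕ) = k then 1 else 0

/-- The columns of an isometry extend to the columns of a unitary matrix. -/
theorem exists_unitary_mul_coordInclusion {M K : ℕ} (H : Matrix (Fin M) (Fin K) ℂ)
    (hH : Hᴴ * H = 1) :
    K ≤ M ∧ ∃ U ∈ unitaryGroup (Fin M) ℂ, U * coordInclusion M K = H := by
  have hK : K ≤ M := by
    have h1 : (Hᴴ * H).rank ≤ H.rank := rank_mul_le_right _ _
    rw [hH, rank_one, Fintype.card_fin] at h1
    simpa using h1.trans H.rank_le_card_height
  refine ⟨hK, ?_⟩
  let v : Fin M → EuclideanSpace ℂ (Fin M) := fun k =>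
    if h : (k : ℕ) < K then WithLp.toLp 2 fun i => H i ⟨k, h⟩ else 0
  have hv : Orthonormal ℂ (({k : Fin M | (k : ℕ) < K} : Set (Fin M)).domRestrict v) := by
    rw [orthonormal_iff_ite]
    rintro ⟨a, ha⟩ ⟨c, hc⟩
    have h := congrFun (congrFun hH ⟨a, ha⟩) ⟨c, hc⟩
    simp only [Set.mem_ofPred_eq] at ha hc
    simp only [mul_apply, conjTranspose_apply, one_apply, Fin.mk.injEq] at h
    simp only [Set.domRestrict_apply, v, ha, hc, dif_pos, PiLp.inner_apply, Subtype.mk.injEq,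
      Fin.ext_iff, ← h]
    exact Finset.sum_congr rfl fun i _ => mul_comm _ _
  obtain ⟨b, hb⟩ := hv.exists_orthonormalBasis_extension_of_card_eq (by simp)
  refine ⟨of fun i k => b k i, ?_, ?_⟩
  · rw [mem_unitaryGroup_iff', star_eq_conjTranspose]
    ext a c
    have h := orthonormal_iff_ite.mp b.orthonormal a c
    rw [PiLp.inner_apply] at h
    simp only [mul_apply, conjTranspose_apply, of_apply, one_apply, ← h]
    exact Finset.sum_congr rfl fun i _ => by simp [mul_comm]
  · ext i k
    have hk : (k : ℕ) < M := k.2.trans_le hK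
    have h := hb ⟨k, hk⟩ k.2
    rw [mul_apply, Finset.sum_eq_single ⟨k, hk⟩]
    · simp [coordInclusion, h, v]
    · intro l _ hl
      have : (l : ℕ) ≠ k := fun h => hl (Fin.ext h)
      simp [coordInclusion, this]
    · simp

theorem coordInclusion_mul_mul_conjTranspose {M N K L : ℕ}
    (D : Matrix (Fin K) (Fin L) ℂ) (i : Fin M) (j : Fin N) :
    (coordInclusion M K * D * (coordInclusion N L)ᴴ) i j =
      if h : (i : ℕ) < K ∧ (j : ℕ) < L then D ⟨i, h.1⟩ ⟨j, h.2⟩ else 0 := by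
  have hi : ∀ (M K : ℕ) (i : Fin M) (f : Fin K → ℂ), ∑ k, coordInclusion M K i k * f k =
      if h : (i : ℕ) < K then f ⟨i, h⟩ else 0 := by
    intro M K i f
    split_ifs with h
    · rw [Finset.sum_eq_single ⟨i, h⟩]
      · simp [coordInclusion]
      · intro k _ hk
        have : (i : ℕ) ≠ k := fun h => hk (Fin.ext h.symm)
        simp [coordInclusion, this]
      · simp
    · refine Finset.sum_eq_zero fun k _ => ?_
      have : (i : ℕ) ≠ k := fun h' => h (h' ▸ k.2)
      simp [coordInclusion, this]
  have hs : ∀ l, (coordInclusion N L)ᴴ l j = coordInclusion N L j l := by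
    intro l
    simp only [conjTranspose_apply, coordInclusion, of_apply]
    split_ifs <;> simp
  rw [mul_apply]
  simp only [hs, mul_comm _ (coordInclusion N L j _), hi]
  simp only [mul_apply, hi]
  by_cases h1 : (i : ℕ) < K <;> by_cases h2 : (j : ℕ) < L <;> simp [h1, h2]

open scoped Kronecker in
theorem diagPad_eq_coordInclusion_mul {n M N k : ℕ}
    (A : Matrix (Fin n) (Fin n) ℂ) :
    diagPad M N k A = coordInclusion M (k * n) *
      ((1 : Matrix (Fin k) (Fin k) ℂ) ⊗ₖ A).submatrix finProdFinEquiv.symm finProdFinEquiv.symm *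
      (coordInclusion N (k * n))ᴴ := by
  ext i j
  rw [coordInclusion_mul_mul_conjTranspose]
  by_cases h : (i : ℕ) < k * n ∧ (j : ℕ) < k * n
  · have hn : 0 < n := Nat.pos_of_ne_zero (by rintro rfl; simp at h)
    rw [dif_pos h]
    simp only [diagPad, of_apply, submatrix_apply, kroneckerMap_apply, one_apply,
      finProdFinEquiv_symm_apply, Fin.ext_iff, Fin.coe_divNat, h.1, h.2, Nat.mod_lt _ hn, true_and]
    split_ifs with h'
    · rw [one_mul]
      rfl
    · rw [zero_mul]
  · rw [dif_neg h]
    exact dif_neg fun h' => h ⟨h'.2.2.1, h'.2.2.2.1⟩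

/-- The matrix whose columns are those of all the matrices `B i`. -/
noncomputable def joinColumns {n M k : ℕ} (B : Fin n → Matrix (Fin M) (Fin k) ℂ) :
    Matrix (Fin M) (Fin (k * n)) ℂ :=
  (of fun r (x : Fin k × Fin n) => B x.2 r x.1).submatrix id finProdFinEquiv.symm

theorem joinColumns_isometry {n M k : ℕ} (B : Fin n → Matrix (Fin M) (Fin k) ℂ)
    (hB : ∀ i j, (B i)ᴴ * B j = if i = j then 1 else 0) :
    (joinColumns B)ᴴ * joinColumns B = 1 := by
  ext x y
  obtain ⟨⟨a, i⟩, rfl⟩ := finProdFinEquiv.surjective x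
  obtain ⟨⟨b, j⟩, rfl⟩ := finProdFinEquiv.surjective y
  have h := congrFun (congrFun (hB i j) a) b
  simp only [mul_apply, conjTranspose_apply] at h
  simp only [joinColumns, mul_apply, conjTranspose_apply, submatrix_apply, of_apply, id_eq,
    Equiv.symm_apply_apply, h, one_apply, EmbeddingLike.apply_eq_iff_eq, Prod.mk.injEq]
  by_cases h1 : i = j <;> simp [h1, one_apply]

open scoped Kronecker in
theorem joinColumns_mul_kronecker_mul {n M N k : ℕ} (B : Fin n → Matrix (Fin M) (Fin k) ℂ)
    (C : Fin n → Matrix (Fin N) (Fin k) ℂ) (A : Matrix (Fin n) (Fin n) ℂ) :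
    joinColumns B *
      ((1 : Matrix (Fin k) (Fin k) ℂ) ⊗ₖ A).submatrix finProdFinEquiv.symm finProdFinEquiv.symm *
      (joinColumns C)ᴴ = ∑ i, ∑ j, A i j • (B i * (C j)ᴴ) := by
  rw [joinColumns, joinColumns, conjTranspose_submatrix, submatrix_mul_equiv, submatrix_mul_equiv]
  ext r s
  simp only [submatrix_apply, id_eq, mul_apply, Matrix.sum_apply, Matrix.smul_apply, conjTranspose_apply,
    of_apply, kroneckerMap_apply, one_apply, Fintype.sum_prod_type, smul_eq_mul, Finset.mul_sum,
    Finset.sum_mul, ite_mul, mul_ite, one_mul, zero_mul, mul_zero]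
  rw [Finset.sum_congr rfl fun a _ => Finset.sum_comm]
  simp only [Finset.sum_ite_irrel, Finset.sum_const_zero, Finset.sum_ite_eq',
    Finset.mem_univ, if_true]
  rw [Finset.sum_congr rfl fun a _ => Finset.sum_comm, Finset.sum_comm]
  refine Finset.sum_congr rfl fun i _ => ?_
  rw [Finset.sum_comm]
  exact Finset.sum_congr rfl fun j _ => Finset.sum_congr rfl fun a _ => by ring

/-- The linear projection `A ↦ (A + Aᵀ) / 2` onto the symmetric matrices. -/
noncomputable def symmetrization (n : ℕ) : Matrix (Fin n) (Fin n) ℂ →ₗ[ℂ] symmSub n :=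
  LinearMap.codRestrict (symmSub n)
    ((1 / 2 : ℂ) • (LinearMap.id + (transposeLinearEquiv (Fin n) (Fin n) ℂ ℂ).toLinearMap))
    fun A => by
      change ((1 / 2 : ℂ) • (A + Aᵀ))ᵀ = (1 / 2 : ℂ) • (A + Aᵀ)
      rw [transpose_smul, transpose_add, transpose_transpose, add_comm]

theorem symmetrization_coe {n : ℕ} (A : symmSub n) : symmetrization n A = A := by
  have hA : (A : Matrix (Fin n) (Fin n) ℂ)ᵀ = A := A.2
  apply Subtype.ext
  change (1 / 2 : ℂ) • ((A : Matrix (Fin n) (Fin n) ℂ) + (A : Matrix (Fin n) (Fin n) ℂ)ᵀ) = A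
  rw [hA, ← two_smul ℂ, smul_smul]
  norm_num

/-- A triple morphism on symmetric matrices is given by matrix units `W i * (W j)ᴴ`, multiplied on
the left by the partial isometry `Φ 1`. -/
theorem triple_morphism_exists_matrix_units {n M N : ℕ} (o : Fin n)
    (Φ : Matrix (Fin n) (Fin n) ℂ →ₗ[ℂ] Matrix (Fin M) (Fin N) ℂ)
    (hsymm : ∀ X, ∃ Y, Yᵀ = Y ∧ Φ X = Φ Y)
    (htriple : ∀ X Y Z : Matrix (Fin n) (Fin n) ℂ, Xᵀ = X → Yᵀ = Y → Zᵀ = Z →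
      Φ (X * Yᴴ * Z + Z * Yᴴ * X) = Φ X * (Φ Y)ᴴ * Φ Z + Φ Z * (Φ Y)ᴴ * Φ X) :
    ∃ (p : Matrix (Fin N) (Fin N) ℂ) (W : Fin n → Matrix (Fin N) (Fin N) ℂ),
      p * p = p ∧ pᴴ = p ∧ (∀ i k, (W i)ᴴ * W k = if i = k then p else 0) ∧
      (∀ i, W i * p = W i) ∧ (∀ i, (Φ 1)ᴴ * Φ 1 * W i = W i) ∧
      ∀ A : Matrix (Fin n) (Fin n) ℂ, Aᵀ = A →
        Φ A = ∑ i, ∑ j, A i j • (Φ 1 * W i * (W j)ᴴ) := by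
  have half : ∀ {a b : Matrix (Fin M) (Fin N) ℂ}, a + a = b + b → a = b := by
    intro a b h
    rw [← two_smul ℂ a, ← two_smul ℂ b] at h
    exact smul_right_injective _ (two_ne_zero (α := ℂ)) h
  set v := Φ 1 with hv
  have hvvv : v * vᴴ * v = v := by
    have h := htriple 1 1 1 transpose_one transpose_one transpose_one
    simp only [conjTranspose_one, mul_one, map_add] at h
    exact (half h).symm
  have hQQ : vᴴ * v * (vᴴ * v) = vᴴ * v := by
    rw [Matrix.mul_assoc, ← Matrix.mul_assoc v, hvvv]
  have hPeirce : ∀ X, v * vᴴ * Φ X = Φ X ∧ Φ X * (vᴴ * v) = Φ X := by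
    intro X
    obtain ⟨Y, hY, hXY⟩ := hsymm X
    rw [hXY]
    have h := htriple 1 1 Y transpose_one transpose_one hY
    simp only [conjTranspose_one, mul_one, one_mul, map_add, ← hv] at h
    rw [Matrix.mul_assoc (Φ Y)] at h
    have h1 : v * vᴴ * Φ Y = v * vᴴ * Φ Y * (vᴴ * v) := by
      have h' := congrArg (fun x => v * vᴴ * x) h
      simp only [Matrix.mul_add, ← Matrix.mul_assoc, hvvv] at h'
      simpa [Matrix.mul_assoc] using h'
    have h2 : Φ Y * (vᴴ * v) = v * vᴴ * Φ Y * (vᴴ * v) := by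
      have h' := congrArg (fun x => x * (vᴴ * v)) h
      simp only [Matrix.add_mul, Matrix.mul_assoc (Φ Y), hQQ] at h'
      exact add_right_cancel h'
    have h3 : v * vᴴ * Φ Y = Φ Y * (vᴴ * v) := h1.trans h2.symm
    have h4 : Φ Y = v * vᴴ * Φ Y := by
      rw [← h3] at h
      exact half h
    exact ⟨h4.symm, by rw [← h3, ← h4]⟩
  have hstar : ∀ X, Xᵀ = X → Φ Xᴴ = v * (Φ X)ᴴ * v := by
    intro X hX
    have h := htriple 1 X 1 transpose_one hX transpose_one
    simp only [mul_one, one_mul, map_add] at h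
    exact half h
  let π : Matrix (Fin n) (Fin n) ℂ →ₗ[ℂ] Matrix (Fin N) (Fin N) ℂ :=
    mulLeftLinearMap (Fin N) ℂ vᴴ ∘ₗ Φ
  have hπ : ∀ X, π X = vᴴ * Φ X := fun _ => rfl
  obtain ⟨p, W, hpp, hpH, hW, hWp, hQW, hA⟩ := jordan_hom_exists_matrix_units o π
    (by
      intro X Y Z hX hY hZ
      have hYH : (Yᴴ)ᵀ = Yᴴ := transpose_conjTranspose_of_transpose_eq hY
      have h := htriple X Yᴴ Z hX hYH hZ
      rw [conjTranspose_conjTranspose, hstar Y hY] at h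
      rw [hπ, h]
      simp only [hπ, conjTranspose_mul, conjTranspose_conjTranspose, Matrix.mul_add, Matrix.mul_assoc])
    (by
      intro X hX
      have h := congrArg conjTranspose (hPeirce X).2
      simp only [conjTranspose_mul, conjTranspose_conjTranspose] at h
      simp only [hπ, hstar X hX, conjTranspose_mul, conjTranspose_conjTranspose]
      rw [← Matrix.mul_assoc, ← Matrix.mul_assoc, h])
    (by
      intro X
      simp only [hπ, ← hv]
      rw [Matrix.mul_assoc, ← Matrix.mul_assoc v, (hPeirce X).1])
    (by
      intro X
      simp only [hπ, ← hv]
      rw [Matrix.mul_assoc, (hPeirce X).2])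
  refine ⟨p, W, hpp, hpH, hW, hWp, hQW, fun A hAT => ?_⟩
  rw [← (hPeirce A).1, Matrix.mul_assoc, ← hπ, hA A hAT]
  simp only [Matrix.mul_sum, Matrix.mul_smul, Matrix.mul_assoc]

/-- a triple morphism from symmetric `n × n` matrices to rectangular
`M × N` matrices is, up to unitaries, a multiple of the identity representation. -/
theorem triple_morphism_symm_to_rectangular (n M N : ℕ) (hn : 2 ≤ n)
    (φ : symmSub n →ₗ[ℂ] Matrix (Fin M) (Fin N) ℂ)
    (hφ : ∀ x y z w : symmSub n,
      (w : Matrix (Fin n) (Fin n) ℂ) =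
        (1/2 : ℂ) • ((x : Matrix (Fin n) (Fin n) ℂ) * (y : Matrix (Fin n) (Fin n) ℂ)ᴴ *
            (z : Matrix (Fin n) (Fin n) ℂ) +
          (z : Matrix (Fin n) (Fin n) ℂ) * (y : Matrix (Fin n) (Fin n) ℂ)ᴴ *
            (x : Matrix (Fin n) (Fin n) ℂ)) →
      φ w = (1/2 : ℂ) • (φ x * (φ y)ᴴ * φ z + φ z * (φ y)ᴴ * φ x)) :
    ∃ α : ℕ, α * n ≤ min M N ∧
      ∃ U ∈ Matrix.unitaryGroup (Fin M) ℂ, ∃ V ∈ Matrix.unitaryGroup (Fin N) ℂ,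
        ∀ A : symmSub n,
          φ A = U * diagPad M N α (A : Matrix (Fin n) (Fin n) ℂ) * V := by
  have hsub : ∀ A : symmSub n, φ A = (φ ∘ₗ symmetrization n) A := fun A => by
    rw [LinearMap.comp_apply, symmetrization_coe]
  obtain ⟨p, W, hpp, hpH, hW, hWp, hQW, hA⟩ :=
    triple_morphism_exists_matrix_units (⟨0, by omega⟩ : Fin n) (φ ∘ₗ symmetrization n)
      (fun X => ⟨symmetrization n X, (symmetrization n X).2, by
        rw [LinearMap.comp_apply, LinearMap.comp_apply, symmetrization_coe]⟩)
      (by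
        intro X Y Z hX hY hZ
        have hsym : ((1 / 2 : ℂ) • (X * Yᴴ * Z + Z * Yᴴ * X))ᵀ =
            (1 / 2 : ℂ) • (X * Yᴴ * Z + Z * Yᴴ * X) := by
          have hYH : (Yᴴ)ᵀ = Yᴴ := transpose_conjTranspose_of_transpose_eq hY
          simp only [transpose_smul, transpose_add, transpose_mul, hX, hYH, hZ, Matrix.mul_assoc]
          rw [add_comm]
        have h := hφ ⟨X, hX⟩ ⟨Y, hY⟩ ⟨Z, hZ⟩ ⟨_, hsym⟩ rfl
        simp only [hsub, map_smul] at h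
        exact smul_right_injective _ (by norm_num : (1 / 2 : ℂ) ≠ 0) h)
  set v := (φ ∘ₗ symmetrization n) 1
  obtain ⟨k, u, hu, hup⟩ := exists_isometry_of_isHermitian_idempotent p hpp hpH
  have hF : ∀ i j, (W i * u)ᴴ * (W j * u) = if i = j then 1 else 0 := by
    intro i j
    have h1 : (W i * u)ᴴ * (W j * u) = uᴴ * ((W i)ᴴ * W j) * u := by
      simp only [conjTranspose_mul, Matrix.mul_assoc]
    rw [h1, hW]
    split_ifs
    · rw [← hup, ← Matrix.mul_assoc, hu, Matrix.one_mul, hu]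
    · simp
  have hG : ∀ i j, (v * W i * u)ᴴ * (v * W j * u) = if i = j then 1 else 0 := by
    intro i j
    have h1 : (v * W i * u)ᴴ * (v * W j * u) = (W i * u)ᴴ * (vᴴ * v * W j * u) := by
      simp only [conjTranspose_mul, Matrix.mul_assoc]
    rw [h1, hQW, hF]
  obtain ⟨hM, U, hU, hUG⟩ :=
    exists_unitary_mul_coordInclusion _ (joinColumns_isometry _ hG)
  obtain ⟨hN, V, hV, hVF⟩ :=
    exists_unitary_mul_coordInclusion _ (joinColumns_isometry _ hF)
  refine ⟨k, le_min hM hN, U, hU, Vᴴ, ?_, fun A => ?_⟩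
  · rw [← star_eq_conjTranspose]
    exact Unitary.star_mem hV
  · rw [hsub, hA A A.2, diagPad_eq_coordInclusion_mul]
    simp only [← Matrix.mul_assoc]
    rw [hUG, Matrix.mul_assoc, ← conjTranspose_mul, hVF, joinColumns_mul_kronecker_mul]
    refine Finset.sum_congr rfl fun i _ => Finset.sum_congr rfl fun j _ => ?_
    rw [conjTranspose_mul, Matrix.mul_assoc (v * W i), ← Matrix.mul_assoc u, hup, ← Matrix.mul_assoc, Matrix.mul_assoc v _ p,
      hWp]
end

section
/- Let m,n ≥ 2 and let φ : M_{m,n}(ℂ) → {B ∈ M_N(ℂ) : Bᵀ = −B} be a triple morphism from the rectangular m×n matrices to the skew-symmetric N×N matrices. Then there exist a natural number k with k·(m+n) ≤ N and unitary matrices U, V ∈ M_N(ℂ) such that φ(A) = U · ((diag_k(A) ⊕ diag_k(Aᵀ)) ⊕ 0) · V for every A ∈ M_{m,n}(ℂ), where (diag_k(A) ⊕ diag_k(Aᵀ)) ⊕ 0 is the N×N matrix whose top-left corner is the block-diagonal matrix with diagonal blocks diag_k(A) and diag_k(Aᵀ) and which is zero elsewhere. -/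
open Matrix

/-- The subspace of skew-symmetric complex `n × n` matrices. -/
noncomputable def skewSub (n : ℕ) : Submodule ℂ (Matrix (Fin n) (Fin n) ℂ) where
  carrier := {A | Aᵀ = -A}
  add_mem' := by
    intro a b ha hb
    simp only [Set.mem_setOf_eq] at *
    rw [Matrix.transpose_add, ha, hb, neg_add]
  zero_mem' := by simp
  smul_mem' := by
    intro c A hA
    simp only [Set.mem_setOf_eq] at *
    rw [Matrix.transpose_smul, hA, smul_neg]

section Grid

variable {R ι κ : Type*} [Ring R] [StarRing R]

/-- The initial projection of the ternary part of a grid, in row `o`. -/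
def IsRectGrid.corner (e : ι → κ → R) (o t : ι) (j : κ) : R :=
  e o j * star (e t j) * (e t j * star (e o j))

theorem IsRectGrid.star_corner (e : ι → κ → R) (o t : ι) (j : κ) :
    star (corner e o t j) = corner e o t j := by
  simp [corner, mul_assoc]

variable [DecidableEq ι] [DecidableEq κ]

/-- A family in a star ring satisfying the (doubled) Jordan triple product relations of the
rectangular matrix units. -/
def IsRectGrid (e : ι → κ → R) : Prop := ∀ i j k l p q,
  e i j * star (e k l) * e p q + e p q * star (e k l) * e i j =
    (if j = l ∧ k = p then e i q else 0) + (if q = l ∧ k = i then e p j else 0)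

namespace IsRectGrid

variable {e : ι → κ → R}

theorem mul_star_mul_col (h : IsRectGrid e) {i k : ι} (hik : i ≠ k) (j : κ) :
    e i j * star (e k j) * e k j + e k j * star (e k j) * e i j = e i j := by
  simpa [hik.symm] using h i j k j k j

theorem mul_star_mul_row (h : IsRectGrid e) (i : ι) {j l : κ} (hjl : j ≠ l) :
    e i j * star (e i l) * e i l + e i l * star (e i l) * e i j = e i j := by
  simpa [hjl] using h i j i l i l

theorem mul_star_mul_quad (h : IsRectGrid e) {i k : ι} (hik : i ≠ k) {j l : κ} (hjl : j ≠ l) :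
    e i j * star (e i l) * e k l + e k l * star (e i l) * e i j = e k j := by
  simpa [hjl, hik] using h i j i l k l

variable [Module ℂ R]

theorem mul_star_mul_self (h : IsRectGrid e) (i : ι) (j : κ) :
    e i j * star (e i j) * e i j = e i j := by
  have := h i j i j i j
  simp only [and_self, if_true] at this
  rw [← two_smul ℂ, ← two_smul ℂ (e i j)] at this
  exact smul_right_injective R (two_ne_zero (α := ℂ)) this

theorem mul_star_mul_col_self (h : IsRectGrid e) {i k : ι} (hik : i ≠ k) (j : κ) :
    e i j * star (e k j) * e i j = 0 := by
  have := h i j k j i j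
  simp only [hik.symm, and_false, if_false, add_zero] at this
  rw [← two_smul ℂ] at this
  exact (smul_eq_zero.1 this).resolve_left two_ne_zero

theorem mul_star_mul_row_self (h : IsRectGrid e) (i : ι) {j l : κ} (hjl : j ≠ l) :
    e i j * star (e i l) * e i j = 0 := by
  have := h i j i l i j
  simp only [hjl, false_and, if_false, add_zero] at this
  rw [← two_smul ℂ] at this
  exact (smul_eq_zero.1 this).resolve_left two_ne_zero

theorem orthogonal (h : IsRectGrid e) {i k : ι} (hik : i ≠ k) {j l : κ} (hjl : j ≠ l) :
    star (e i j) * e k l = 0 ∧ e k l * star (e i j) = 0 := by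
  have h1 : e i j * star (e i j) * e k l + e k l * star (e i j) * e i j = 0 := by
    simpa [hik, hik.symm, hjl, hjl.symm] using h i j i j k l
  have h0 := h.mul_star_mul_self i j
  have h0' : star (e i j) * e i j * star (e i j) = star (e i j) := by
    simpa [mul_assoc] using congrArg star h0
  generalize e i j = a at *
  generalize e k l = b at *
  have h2 : a * star a * b + a * star a * b * star a * a = 0 := by
    calc _ = (a * star a * a) * star a * b + a * star a * b * star a * a := by rw [h0]
      _ = a * star a * (a * star a * b + b * star a * a) := by noncomm_ring
      _ = 0 := by rw [h1, mul_zero]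
  have h3 : a * star a * b * star a * a + b * star a * a = 0 := by
    calc _ = a * star a * b * star a * a + b * star a * (a * star a * a) := by rw [h0]
      _ = (a * star a * b + b * star a * a) * (star a * a) := by noncomm_ring
      _ = 0 := by rw [h1, zero_mul]
  have h4 : a * star a * b = 0 := by
    have : a * star a * b + a * star a * b = 0 := by
      have e1 := eq_neg_of_add_eq_zero_left h2
      have e2 := eq_neg_of_add_eq_zero_right h3
      have e3 : a * star a * b = b * star a * a := e1.trans e2.symm
      nth_rewrite 2 [e3]
      exact h1
    rw [← two_smul ℂ] at this
    exact (smul_eq_zero.1 this).resolve_left two_ne_zero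
  have h5 : b * star a * a = 0 := by rwa [h4, zero_add] at h1
  constructor
  · rw [← h0', mul_assoc (star a), mul_assoc (star a), h4, mul_zero]
  · rw [← h0', ← mul_assoc, ← mul_assoc, h5, zero_mul]

theorem star_mul_eq_zero (h : IsRectGrid e) {i k : ι} (hik : i ≠ k) {j l : κ} (hjl : j ≠ l) :
    star (e i j) * e k l = 0 := (h.orthogonal hik hjl).1

theorem mul_star_eq_zero (h : IsRectGrid e) {i k : ι} (hik : i ≠ k) {j l : κ} (hjl : j ≠ l) :
    e i j * star (e k l) = 0 := (h.orthogonal hik.symm hjl.symm).2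

theorem mul_star_col_congr (h : IsRectGrid e) {i k : ι} (hik : i ≠ k) (j l : κ) :
    e i j * star (e k j) = e i l * star (e k l) := by
  rcases eq_or_ne j l with rfl | hjl
  · rfl
  have h1 := congrArg star (h.mul_star_mul_quad hik hjl)
  simp only [star_add, star_mul, star_star] at h1
  have h2 := h.mul_star_mul_row i hjl.symm
  calc e i j * star (e k j)
      = (e i j * star (e k l)) * (e i l * star (e i j))
        + e i j * star (e i j) * e i l * star (e k l) := by rw [← h1]; noncomm_ring
    _ = e i j * star (e i j) * e i l * star (e k l)
        + e i l * star (e i j) * (e i j * star (e k l)) := by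
          rw [h.mul_star_eq_zero hik hjl]; simp
    _ = (e i l * star (e i j) * e i j + e i j * star (e i j) * e i l) * star (e k l) := by
          noncomm_ring
    _ = _ := by rw [h2]

/-- Multiplicativity of the left matrix units `e i j * star (e k j)` off the diagonal. -/
theorem mul_star_mul_mul_star (h : IsRectGrid e) [Nontrivial κ] {i k p : ι} (hik : i ≠ k)
    (hip : i ≠ p) (j : κ) :
    e i j * star (e k j) * (e k j * star (e p j)) = e i j * star (e p j) := by
  obtain ⟨l, hl⟩ := exists_ne j
  have h1 := h.mul_star_mul_col hik j
  have h2 : e k j * star (e k j) * (e i j * star (e p j)) = 0 := by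
    rw [h.mul_star_col_congr hip j l, mul_assoc, ← mul_assoc (star _),
      h.star_mul_eq_zero hik.symm hl.symm]; simp
  calc _ = (e i j * star (e k j) * e k j + e k j * star (e k j) * e i j) * star (e p j)
        - e k j * star (e k j) * (e i j * star (e p j)) := by noncomm_ring
    _ = _ := by rw [h1, h2, sub_zero]

theorem corner_congr_row (h : IsRectGrid e) [Nontrivial κ] {o t i : ι} (hot : o ≠ t) (hoi : o ≠ i)
    (j : κ) :
    corner e o t j = corner e o i j := by
  rcases eq_or_ne t i with rfl | hti
  · rfl
  unfold corner
  rw [← h.mul_star_mul_mul_star hti hot.symm j, ← mul_assoc,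
    h.mul_star_mul_mul_star hot hoi j]

theorem corner_congr_col (h : IsRectGrid e) {o t : ι} (hot : o ≠ t) (j l : κ) :
    corner e o t j = corner e o t l := by
  unfold corner
  rw [h.mul_star_col_congr hot j l, h.mul_star_col_congr hot.symm j l]

theorem corner_mul (h : IsRectGrid e) {o t : ι} (hot : o ≠ t) (j : κ) :
    corner e o t j * e o j = e o j * star (e t j) * e t j := by
  have h0 := h.mul_star_mul_self o j
  have h1 := h.mul_star_mul_col hot j
  unfold corner
  calc _ = (e o j * star (e t j) * e t j + e t j * star (e t j) * e o j) * star (e o j) * e o j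
        - e t j * star (e t j) * (e o j * star (e o j) * e o j) := by noncomm_ring
    _ = (e o j * star (e t j) * e t j + e t j * star (e t j) * e o j)
        - e t j * star (e t j) * e o j := by rw [h1, h0]
    _ = _ := by noncomm_ring

theorem corner_mul_mul_star_self (h : IsRectGrid e) {o t : ι} (hot : o ≠ t) (j : κ) :
    corner e o t j * (e o j * star (e o j)) = corner e o t j := by
  rw [← mul_assoc, h.corner_mul hot, corner]
  noncomm_ring

theorem corner_mul_mul_star (h : IsRectGrid e) {o t : ι} (hot : o ≠ t) {j l : κ} (hjl : j ≠ l)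
    (c : κ) :
    corner e o t c * (e o j * star (e o l)) = 0 := by
  have h1 := congrArg star (h.mul_star_mul_row_self o hjl.symm)
  simp only [star_mul, star_star, star_zero] at h1
  rw [h.corner_congr_col hot c l, corner]
  calc _ = e o l * star (e t l) * e t l * (star (e o l) * (e o j * star (e o l))) := by
        noncomm_ring
    _ = 0 := by rw [h1, mul_zero]

theorem mul_star_mul_corner (h : IsRectGrid e) {o t : ι} (hot : o ≠ t) (j : κ) :
    e t j * star (e o j) * corner e o t j = e t j * star (e o j) := by
  have h1 := h.mul_star_mul_col hot j
  have h0 := congrArg star (h.mul_star_mul_self o j)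
  simp only [star_mul, star_star] at h0
  unfold corner
  calc _ = e t j * star (e o j) *
        (e o j * star (e t j) * e t j + e t j * star (e t j) * e o j) * star (e o j)
        - (e t j * star (e o j) * e t j) * star (e t j) * e o j * star (e o j) := by noncomm_ring
    _ = e t j * (star (e o j) * (e o j * star (e o j))) := by
        rw [h1, h.mul_star_mul_col_self hot.symm j]; noncomm_ring
    _ = _ := by rw [h0]

theorem corner_mul_corner (h : IsRectGrid e) {o t : ι} (hot : o ≠ t) (j : κ) :
    corner e o t j * corner e o t j = corner e o t j := by
  conv_lhs => enter [1]; unfold corner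
  rw [mul_assoc, h.mul_star_mul_corner hot, corner]

/-- The left matrix unit moving row `o` to row `i`. -/
def rowShift (e : ι → κ → R) (o t : ι) (c : κ) (i : ι) : R :=
  if i = o then corner e o t c else e i c * star (e o c)

theorem rowShift_mul_corner_mul (h : IsRectGrid e) [Nontrivial κ] {o t : ι} (hot : o ≠ t) (c : κ)
    (i : ι) (j : κ) :
    ∃ s, i ≠ s ∧
      rowShift e o t c i * corner e o t c * e o j = e i j * star (e s j) * e s j := by
  rcases eq_or_ne i o with rfl | hi
  · refine ⟨t, hot, ?_⟩
    rw [rowShift, if_pos rfl, h.corner_mul_corner hot, h.corner_congr_col hot c j,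
      h.corner_mul hot]
  · refine ⟨o, hi, ?_⟩
    rw [rowShift, if_neg hi, h.corner_congr_row hot hi.symm, h.mul_star_mul_corner hi.symm,
      h.mul_star_col_congr hi c j]

theorem star_rowShift_mul_rowShift (h : IsRectGrid e) [Nontrivial κ] {o t : ι} (hot : o ≠ t)
    (c : κ) (i i' : ι) :
    star (rowShift e o t c i) * rowShift e o t c i' = if i = i' then corner e o t c else 0 := by
  obtain ⟨l, hl⟩ := exists_ne c
  have key : ∀ i, i ≠ o → corner e o t c * (e i c * star (e o c)) = 0 := by
    intro i hi
    rw [h.mul_star_col_congr hi c l, corner]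
    calc _ = e o c * star (e t c) * e t c * (star (e o c) * e i l) * star (e o l) := by
          noncomm_ring
      _ = 0 := by rw [h.star_mul_eq_zero hi.symm hl.symm]; simp
  by_cases hi : i = o <;> by_cases hi' : i' = o
  · subst hi; subst hi'
    simp [rowShift, star_corner, h.corner_mul_corner hot]
  · subst hi
    simp [rowShift, star_corner, hi', key i' hi', Ne.symm hi']
  · subst hi'
    have := congrArg star (key i hi)
    rw [star_mul, star_corner, star_zero] at this
    simp [rowShift, hi, -star_mul, this]
  · by_cases hii : i = i'
    · subst hii
      simp only [rowShift, hi, if_false, if_true]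
      rw [h.corner_congr_row hot (Ne.symm hi), corner]
      simp
    · simp only [rowShift, hi, hi', hii, if_false]
      rw [h.mul_star_col_congr hi' c l, star_mul, star_star]
      calc _ = e o c * (star (e i c) * e i' l) * star (e o l) := by noncomm_ring
        _ = 0 := by rw [h.star_mul_eq_zero hii hl.symm]; simp

theorem star_rowShift_mul_mul (h : IsRectGrid e) [Nontrivial κ] {o t : ι} (hot : o ≠ t) (c : κ)
    (i : ι) (j : κ) :
    ∃ l, star (rowShift e o t c i) * e o j *
      (star (e o l) * e t l * (star (e t l) * e o l)) = 0 := by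
  obtain ⟨l, hl⟩ := exists_ne j
  refine ⟨l, ?_⟩
  by_cases hi : i = o
  · subst hi
    rw [rowShift, if_pos rfl, star_corner, h.corner_congr_col hot c j, h.corner_mul hot]
    calc _ = e i j * star (e t j) * (e t j * star (e i l)) *
            (e t l * (star (e t l) * e i l)) := by noncomm_ring
      _ = 0 := by rw [h.mul_star_eq_zero hot.symm hl.symm]; simp
  · rw [rowShift, if_neg hi, h.mul_star_col_congr hi c l, star_mul, star_star]
    rw [mul_assoc (e o l), h.star_mul_eq_zero hi hl]
    simp

end IsRectGrid

end Grid

section Isometry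

variable {ν ι : Type*} [Fintype ν] [DecidableEq ι]

theorem orthonormal_col_of_conjTranspose_mul_self {X : Matrix ν ι ℂ} (hX : Xᴴ * X = 1) :
    Orthonormal ℂ fun x => (WithLp.toLp 2 fun i => X i x : EuclideanSpace ℂ ν) := by
  rw [orthonormal_iff_ite]
  intro x y
  rw [← Matrix.one_apply, ← hX]
  simp [PiLp.inner_apply, Matrix.mul_apply, mul_comm]

theorem card_le_card_of_conjTranspose_mul_self [Fintype ι] {X : Matrix ν ι ℂ} (hX : Xᴴ * X = 1) :
    Fintype.card ι ≤ Fintype.card ν := by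
  simpa using
    (orthonormal_col_of_conjTranspose_mul_self hX).linearIndependent.fintype_card_le_finrank

theorem exists_unitary_extending [DecidableEq ν] {X : Matrix ν ι ℂ} (hX : Xᴴ * X = 1) {σ : ι → ν}
    (hσ : Function.Injective σ) :
    ∃ U ∈ Matrix.unitaryGroup ν ℂ, ∀ i x, U i (σ x) = X i x := by
  set c : ι → EuclideanSpace ℂ ν := fun x => WithLp.toLp 2 fun i => X i x
  have hc : Orthonormal ℂ c := orthonormal_col_of_conjTranspose_mul_self hX
  have hv : Orthonormal ℂ ((Set.range σ).domRestrict (Function.extend σ c 0)) := by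
    have := hc.comp _ (Equiv.ofInjective σ hσ).symm.injective
    convert this using 1
    ext1 ⟨_, x, rfl⟩
    simp [Set.domRestrict, hσ.extend_apply]
  obtain ⟨b, hb⟩ := hv.exists_orthonormalBasis_extension_of_card_eq (by simp)
  refine ⟨Matrix.of fun i j => b j i, ?_, fun i x => ?_⟩
  · rw [Matrix.mem_unitaryGroup_iff']
    ext x y
    rw [Matrix.one_apply, ← orthonormal_iff_ite.1 b.orthonormal x y]
    simp [PiLp.inner_apply, Matrix.mul_apply, Matrix.star_apply, mul_comm]
  · simp [hb (σ x) ⟨x, rfl⟩, hσ.extend_apply, c]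

end Isometry

theorem exists_isometry_mul_conjTranspose_eq {ν : Type*} [Fintype ν] [DecidableEq ν]
    {p : Matrix ν ν ℂ} (hp : pᴴ = p) (hpp : p * p = p) :
    ∃ (k : ℕ) (v : Matrix ν (Fin k) ℂ), vᴴ * v = 1 ∧ v * vᴴ = p := by
  set S := LinearMap.range (Matrix.toEuclideanLin p)
  set b := stdOrthonormalBasis ℂ S
  have hfix : ∀ y : S, Matrix.toEuclideanLin p y = y := by
    rintro ⟨_, z, rfl⟩
    ext i
    simp [Matrix.toLpLin_apply, hpp]
  refine ⟨_, Matrix.of fun i s => (b s : EuclideanSpace ℂ ν) i, ?_, ?_⟩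
  · ext s t
    rw [Matrix.one_apply, ← orthonormal_iff_ite.1 b.orthonormal s t]
    simp [PiLp.inner_apply, Matrix.mul_apply, mul_comm]
  · set v : Matrix ν _ ℂ := Matrix.of fun i s => (b s : EuclideanSpace ℂ ν) i
    have h1 : p * v = v := by
      ext i s
      have := congrArg (fun y : EuclideanSpace ℂ ν => y i) (hfix (b s))
      simpa [Matrix.toLpLin_apply, Matrix.mul_apply, Matrix.mulVec, dotProduct, v] using this
    have h2 : v * vᴴ * p = p := by
      ext i j
      set y : S := ⟨_, EuclideanSpace.single j 1, rfl⟩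
      have hy : ∀ i, (y : EuclideanSpace ℂ ν) i = p i j := by
        intro i
        simp [y, Matrix.toLpLin_apply]
      have := congrArg (fun y : S => (y : EuclideanSpace ℂ ν) i) (b.sum_repr' y)
      simp only [hy] at this
      rw [← this, Matrix.mul_assoc, Matrix.mul_apply]
      simp [PiLp.inner_apply, Matrix.mul_apply, hy, v, mul_comm]
    have h3 := congrArg Matrix.conjTranspose h1
    rw [Matrix.conjTranspose_mul, hp] at h3
    rw [← h2, Matrix.mul_assoc, h3]

theorem mul_diagPadAt_mul {n m N k r c : ℕ} (U V : Matrix (Fin N) (Fin N) ℂ)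
    (X : Fin n → Matrix (Fin N) (Fin k) ℂ) (Y : Fin m → Matrix (Fin k) (Fin N) ℂ)
    (f : Fin k × Fin n → Fin N) (hf : ∀ x, (f x : ℕ) = r + (x.2 + n * x.1))
    (g : Fin k × Fin m → Fin N) (hg : ∀ x, (g x : ℕ) = c + (x.2 + m * x.1))
    (hU : ∀ i x, U i (f x) = X x.2 i x.1) (hV : ∀ x j, V (g x) j = Y x.2 x.1 j)
    (A : Matrix (Fin n) (Fin m) ℂ) :
    U * diagPadAt N N r c k A * V = ∑ a, ∑ b, A a b • (X a * Y b) := by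
  have key : ∀ x y, diagPadAt N N r c k A (f x) (g y) = if x.1 = y.1 then A x.2 y.2 else 0 := by
    intro x y
    have hn : 0 < n := x.2.pos
    have hm : 0 < m := y.2.pos
    have h1 : ((x.2 : ℕ) + n * x.1) < k * n := by
      simpa using (finProdFinEquiv x).isLt
    have h2 : ((y.2 : ℕ) + m * y.1) < k * m := by
      simpa using (finProdFinEquiv y).isLt
    simp [diagPadAt, hf, hg, Nat.mod_lt _ hn, Nat.mod_lt _ hm, h1, h2,
      Nat.add_mul_div_left _ _ hn, Nat.add_mul_div_left _ _ hm, Nat.div_eq_of_lt x.2.isLt,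
      Nat.div_eq_of_lt y.2.isLt, Nat.mod_eq_of_lt x.2.isLt, Nat.mod_eq_of_lt y.2.isLt,
      Fin.val_inj]
  have hzero : ∀ i j, diagPadAt N N r c k A i j ≠ 0 → i ∈ Set.range f ∧ j ∈ Set.range g := by
    intro i j hij
    simp only [diagPadAt, Matrix.of_apply, ne_eq, dite_eq_right_iff, not_forall] at hij
    obtain ⟨⟨hr, hc, hin, hjm, hik, hjk, -⟩, -⟩ := hij
    refine ⟨⟨(⟨(i - r) / n, Nat.div_lt_of_lt_mul (by rwa [mul_comm])⟩, ⟨_, hin⟩), ?_⟩,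
      ⟨(⟨(j - c) / m, Nat.div_lt_of_lt_mul (by rwa [mul_comm])⟩, ⟨_, hjm⟩), ?_⟩⟩
    · apply Fin.ext
      rw [hf]
      simp only [Nat.mod_add_div]
      omega
    · apply Fin.ext
      rw [hg]
      simp only [Nat.mod_add_div]
      omega
  have hfi : Function.Injective f := by
    intro x y hxy
    apply finProdFinEquiv.injective
    apply Fin.ext
    have := congrArg Fin.val hxy
    rw [hf, hf] at this
    simpa using this
  have hgi : Function.Injective g := by
    intro x y hxy
    apply finProdFinEquiv.injective
    apply Fin.ext
    have := congrArg Fin.val hxy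
    rw [hg, hg] at this
    simpa using this
  ext i j
  rw [Matrix.mul_assoc, Matrix.mul_apply,
    ← Fintype.sum_of_injective f hfi (fun x => ∑ y, U i (f x) *
      (diagPadAt N N r c k A (f x) (g y) * V (g y) j))]
  · simp only [key, hU, hV, Fintype.sum_prod_type, Matrix.sum_apply, Matrix.smul_apply,
      Matrix.mul_apply, smul_eq_mul, Finset.mul_sum, ite_mul, zero_mul, mul_ite, mul_zero]
    rw [Finset.sum_comm]
    refine Finset.sum_congr rfl fun a _ => ?_
    rw [Finset.sum_comm (s := Finset.univ (α := Fin m))]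
    refine Finset.sum_congr rfl fun s _ => ?_
    rw [Finset.sum_comm]
    refine Finset.sum_congr rfl fun b _ => ?_
    rw [Finset.sum_ite_eq]
    simp only [Finset.mem_univ, if_true]
    ring
  · intro i' hi'
    rw [Matrix.mul_apply]
    simp only [Finset.mul_sum]
    refine Finset.sum_eq_zero fun j' _ => ?_
    rw [not_not.1 fun h0 => hi' (hzero i' j' h0).1]
    simp
  · intro x
    rw [Matrix.mul_apply, Finset.mul_sum]
    refine Fintype.sum_of_injective g hgi _ _ (fun j' hj' => ?_) fun y => rfl
    rw [not_not.1 fun h0 => hj' (hzero _ j' h0).2]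
    simp

theorem conjTranspose_fromBlockCols_mul_self {N k m n : ℕ} {P : Fin m → Matrix (Fin N) (Fin k) ℂ}
    {Q : Fin n → Matrix (Fin N) (Fin k) ℂ}
    (hP : ∀ a a', (P a)ᴴ * P a' = if a = a' then 1 else 0)
    (hQ : ∀ b b', (Q b)ᴴ * Q b' = if b = b' then 1 else 0)
    (hPQ : ∀ a b, (P a)ᴴ * Q b = 0)
    {X : Matrix (Fin N) ((Fin k × Fin m) ⊕ (Fin k × Fin n)) ℂ}
    (hX : X = Matrix.of fun i => Sum.elim (fun x => P x.2 i x.1) fun x => Q x.2 i x.1) :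
    Xᴴ * X = 1 := by
  have hQP : ∀ b a, (Q b)ᴴ * P a = 0 := fun b a => by
    simpa using congrArg Matrix.conjTranspose (hPQ a b)
  subst hX
  ext (⟨s, a⟩ | ⟨s, a⟩) (⟨t, b⟩ | ⟨t, b⟩)
  · have := congrFun₂ (hP a b) s t
    rw [Matrix.mul_apply] at this
    rw [Matrix.mul_apply]
    refine this.trans ?_
    by_cases hab : a = b <;> simp [hab, Matrix.one_apply]
  · have := congrFun₂ (hPQ a b) s t
    rw [Matrix.mul_apply] at this
    rw [Matrix.mul_apply]
    exact this.trans (by simp)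
  · have := congrFun₂ (hQP a b) s t
    rw [Matrix.mul_apply] at this
    rw [Matrix.mul_apply]
    exact this.trans (by simp)
  · have := congrFun₂ (hQ a b) s t
    rw [Matrix.mul_apply] at this
    rw [Matrix.mul_apply]
    refine this.trans ?_
    by_cases hab : a = b <;> simp [hab, Matrix.one_apply]

/-- The columns of two families of `N × k` matrices, when jointly orthonormal, can be taken as the
leading columns of a unitary matrix. -/
theorem exists_unitary_of_blockCols {N k m n : ℕ} {P : Fin m → Matrix (Fin N) (Fin k) ℂ}
    {Q : Fin n → Matrix (Fin N) (Fin k) ℂ}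
    (hP : ∀ a a', (P a)ᴴ * P a' = if a = a' then 1 else 0)
    (hQ : ∀ b b', (Q b)ᴴ * Q b' = if b = b' then 1 else 0)
    (hPQ : ∀ a b, (P a)ᴴ * Q b = 0) :
    k * m + k * n ≤ N ∧ ∃ U ∈ Matrix.unitaryGroup (Fin N) ℂ,
      ∃ (f : Fin k × Fin m → Fin N) (g : Fin k × Fin n → Fin N),
        (∀ x, (f x : ℕ) = 0 + (x.2 + m * x.1)) ∧ (∀ x, (g x : ℕ) = k * m + (x.2 + n * x.1)) ∧
        (∀ i x, U i (f x) = P x.2 i x.1) ∧ ∀ i x, U i (g x) = Q x.2 i x.1 := by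
  have hX := conjTranspose_fromBlockCols_mul_self hP hQ hPQ rfl
  have hN : k * m + k * n ≤ N := by simpa using card_le_card_of_conjTranspose_mul_self hX
  refine ⟨hN, ?_⟩
  set σ : (Fin k × Fin m) ⊕ (Fin k × Fin n) → Fin N := fun x =>
    Fin.castLE hN (finSumFinEquiv (Sum.map finProdFinEquiv finProdFinEquiv x)) with hσ
  have hinj : Function.Injective σ :=
    (Fin.castLE_injective hN).comp (finSumFinEquiv.injective.comp
      (finProdFinEquiv.injective.sumMap finProdFinEquiv.injective))
  obtain ⟨U, hU, h⟩ := exists_unitary_extending hX hinj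
  exact ⟨U, hU, fun x => σ (.inl x), fun x => σ (.inr x), fun x => by simp [hσ],
    fun x => by simp [hσ], fun i x => h i (.inl x), fun i x => h i (.inr x)⟩

theorem exists_unitary_of_isRectGrid {m n N : ℕ} (hm : 2 ≤ m) (hn : 2 ≤ n)
    {e : Fin m → Fin n → Matrix (Fin N) (Fin N) ℂ} (h : IsRectGrid e)
    (hskew : ∀ i j, (e i j)ᵀ = -e i j) :
    ∃ k : ℕ, k * (m + n) ≤ N ∧
      ∃ U ∈ Matrix.unitaryGroup (Fin N) ℂ, ∃ V ∈ Matrix.unitaryGroup (Fin N) ℂ,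
        ∀ A : Matrix (Fin m) (Fin n) ℂ, ∑ a, ∑ b, A a b • e a b =
          U * (diagPadAt N N 0 0 k A + diagPadAt N N (k * m) (k * n) k Aᵀ) * V := by
  have : Nontrivial (Fin n) := Fin.nontrivial_iff_two_le.2 hn
  set o : Fin m := ⟨0, by omega⟩
  set t : Fin m := ⟨1, by omega⟩
  have hot : o ≠ t := by simp [o, t]
  set c : Fin n := ⟨0, by omega⟩
  have hskew' : ∀ i j, (star (e i j))ᵀ = -star (e i j) := fun i j => by
    rw [Matrix.star_eq_conjTranspose, Matrix.conjTranspose_transpose,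
      ← Matrix.transpose_conjTranspose,
      hskew, Matrix.conjTranspose_neg]
  have hconj : ∀ {k : ℕ} (M : Matrix (Fin N) (Fin k) ℂ), Mᴴᵀᴴ = Mᵀ := fun M => by
    ext
    simp
  set p := IsRectGrid.corner e o t c with hp
  obtain ⟨k, v, hv, hvp⟩ := exists_isometry_mul_conjTranspose_eq
    (IsRectGrid.star_corner e o t c) (h.corner_mul_corner hot c)
  rw [← hp] at hvp
  have hvp' : vᴴ * p = vᴴ := by rw [← hvp, ← Matrix.mul_assoc, hv, Matrix.one_mul]
  set L := IsRectGrid.rowShift e o t c with hL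
  set ξ : Fin m → Matrix (Fin N) (Fin k) ℂ := fun i => L i * v with hξ
  set η : Fin n → Matrix (Fin N) (Fin k) ℂ := fun j => (e o j)ᴴ * v with hη
  have hξξ : ∀ a a', (ξ a)ᴴ * ξ a' = if a = a' then 1 else 0 := by
    intro a a'
    have := h.star_rowShift_mul_rowShift hot c a a'
    rw [Matrix.star_eq_conjTranspose, ← hL, ← hp] at this
    calc _ = vᴴ * ((L a)ᴴ * L a') * v := by
          simp only [hξ, Matrix.conjTranspose_mul, Matrix.mul_assoc]
      _ = _ := by rw [this]; split_ifs <;> simp [hvp', hv]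
  have hηη : ∀ b b', (η b)ᴴ * η b' = if b = b' then 1 else 0 := by
    intro b b'
    have h1 : (η b)ᴴ * η b' = vᴴ * (p * (e o b * star (e o b'))) * v := by
      rw [← Matrix.mul_assoc vᴴ p, hvp']
      simp only [hη, Matrix.conjTranspose_mul, Matrix.mul_assoc, Matrix.star_eq_conjTranspose,
        Matrix.conjTranspose_conjTranspose]
    rw [h1]
    by_cases hb : b = b'
    · subst hb
      rw [hp, h.corner_congr_col hot c b, h.corner_mul_mul_star_self hot,
        ← h.corner_congr_col hot c b, ← hp, hvp', hv, if_pos rfl]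
    · rw [hp, h.corner_mul_mul_star hot hb, if_neg hb]
      simp
  have hξη : ∀ a b, (ξ a)ᴴ * (η b)ᴴᵀ = 0 := by
    intro a b
    obtain ⟨l, hl⟩ := h.star_rowShift_mul_mul hot c a b
    have hpT : pᵀ = star (e o l) * e t l * (star (e t l) * e o l) := by
      rw [hp, h.corner_congr_col hot c l, IsRectGrid.corner]
      simp only [Matrix.transpose_mul, hskew, hskew', neg_mul_neg]
    have hvT : vᴴᵀ = pᵀ * vᴴᵀ := by rw [← Matrix.transpose_mul, hvp']
    calc _ = -(vᴴ * (star (L a) * e o b * pᵀ) * vᴴᵀ) := by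
          rw [Matrix.mul_assoc, Matrix.mul_assoc (star (L a) * e o b), ← hvT]
          simp only [hξ, hη, Matrix.conjTranspose_mul, Matrix.conjTranspose_conjTranspose,
            Matrix.transpose_mul, hskew, Matrix.star_eq_conjTranspose, Matrix.mul_assoc,
            Matrix.neg_mul, Matrix.mul_neg]
      _ = 0 := by rw [hpT, hl]; simp
  have he : ∀ a b, e a b = ξ a * (η b)ᴴ + (η b)ᴴᵀ * (-(ξ a)ᴴᵀ)ᴴ := by
    intro a b
    obtain ⟨s, hs, hab⟩ := h.rowShift_mul_corner_mul hot c a b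
    have h1 : ξ a * (η b)ᴴ = e a b * star (e s b) * e s b := by
      rw [← hab, ← hp, ← hvp, ← hL]
      simp only [hξ, hη, Matrix.conjTranspose_mul, Matrix.conjTranspose_conjTranspose,
        Matrix.mul_assoc]
    have h2 : (η b)ᴴᵀ * (-(ξ a)ᴴᵀ)ᴴ = -(ξ a * (η b)ᴴ)ᵀ := by
      rw [Matrix.transpose_mul, Matrix.conjTranspose_neg, Matrix.mul_neg, hconj]
    rw [h2, h1]
    simp only [Matrix.transpose_mul, hskew, hskew', neg_mul_neg, neg_neg, Matrix.neg_mul]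
    rw [← Matrix.mul_assoc, h.mul_star_mul_col hs b]
  obtain ⟨hN, U, hU, f, g, hf, hg, hUf, hUg⟩ :=
    exists_unitary_of_blockCols (P := ξ) (Q := fun b => (η b)ᴴᵀ) hξξ (fun b b' => by
      have := congrArg Matrix.transpose (hηη b' b)
      rw [Matrix.transpose_mul] at this
      rw [hconj, this]
      by_cases hb : b = b' <;> simp [hb, Ne.symm]) hξη
  obtain ⟨-, W, hW, f', g', hf', hg', hWf, hWg⟩ :=
    exists_unitary_of_blockCols (P := η) (Q := fun a => -(ξ a)ᴴᵀ) hηη (fun a a' => by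
      have := congrArg Matrix.transpose (hξξ a' a)
      rw [Matrix.transpose_mul] at this
      rw [Matrix.conjTranspose_neg, Matrix.neg_mul, Matrix.mul_neg, neg_neg, hconj, this]
      by_cases hb : a = a' <;> simp [hb, Ne.symm]) (fun b a => by
      have := congrArg Matrix.transpose (hξη a b)
      rw [Matrix.transpose_mul, Matrix.transpose_transpose] at this
      rw [Matrix.mul_neg, this, Matrix.transpose_zero, neg_zero])
  refine ⟨k, by rwa [mul_add], U, hU, star W, Unitary.star_mem hW, fun A => ?_⟩
  rw [Matrix.mul_add, Matrix.add_mul,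
    mul_diagPadAt_mul U (star W) ξ (fun b => (η b)ᴴ) f hf f' hf' hUf
      (fun x j => by rw [Matrix.star_apply, hWf]; rfl),
    mul_diagPadAt_mul U (star W) (fun b => (η b)ᴴᵀ) (fun a => (-(ξ a)ᴴᵀ)ᴴ) g hg g' hg' hUg
      (fun x j => by rw [Matrix.star_apply, hWg]; rfl),
    Finset.sum_comm (s := Finset.univ (α := Fin n)),
    ← Finset.sum_add_distrib]
  refine Finset.sum_congr rfl fun a _ => ?_
  rw [← Finset.sum_add_distrib]
  refine Finset.sum_congr rfl fun b _ => ?_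
  rw [Matrix.transpose_apply, ← smul_add, ← he]

/-- a triple morphism from rectangular `m × n` matrices to skew-symmetric
`N × N` matrices is, up to unitaries, of the form `A ↦ (diag_k(A) ⊕ diag_k(Aᵀ)) ⊕ 0`. -/
theorem triple_morphism_rectangular_to_skew (m n N : ℕ) (hm : 2 ≤ m) (hn : 2 ≤ n)
    (φ : Matrix (Fin m) (Fin n) ℂ →ₗ[ℂ] skewSub N)
    (hφ : ∀ x y z : Matrix (Fin m) (Fin n) ℂ,
      (φ ((1/2 : ℂ) • (x * yᴴ * z + z * yᴴ * x)) : Matrix (Fin N) (Fin N) ℂ) =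
        (1/2 : ℂ) • ((φ x : Matrix (Fin N) (Fin N) ℂ) * (φ y : Matrix (Fin N) (Fin N) ℂ)ᴴ *
            (φ z : Matrix (Fin N) (Fin N) ℂ) +
          (φ z : Matrix (Fin N) (Fin N) ℂ) * (φ y : Matrix (Fin N) (Fin N) ℂ)ᴴ *
            (φ x : Matrix (Fin N) (Fin N) ℂ))) :
    ∃ k : ℕ, k * (m + n) ≤ N ∧
      ∃ U ∈ Matrix.unitaryGroup (Fin N) ℂ, ∃ V ∈ Matrix.unitaryGroup (Fin N) ℂ,
        ∀ A : Matrix (Fin m) (Fin n) ℂ,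
          (φ A : Matrix (Fin N) (Fin N) ℂ) =
            U * (diagPadAt N N 0 0 k A + diagPadAt N N (k * m) (k * n) k Aᵀ) * V := by
  have hφ' : ∀ x y z : Matrix (Fin m) (Fin n) ℂ,
      (φ x : Matrix (Fin N) (Fin N) ℂ) * star (φ y : Matrix (Fin N) (Fin N) ℂ) *
          (φ z : Matrix (Fin N) (Fin N) ℂ) +
        (φ z : Matrix (Fin N) (Fin N) ℂ) * star (φ y : Matrix (Fin N) (Fin N) ℂ) *
          (φ x : Matrix (Fin N) (Fin N) ℂ) =
      (φ (x * yᴴ * z) : Matrix (Fin N) (Fin N) ℂ) + φ (z * yᴴ * x) := by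
    intro x y z
    have := hφ x y z
    rw [map_smul, Submodule.coe_smul] at this
    have h2 := smul_right_injective _ (by norm_num : (1 / 2 : ℂ) ≠ 0) this
    rw [map_add, Submodule.coe_add] at h2
    exact h2.symm
  have hgrid : IsRectGrid fun i j => (φ (Matrix.single i j 1) : Matrix (Fin N) (Fin N) ℂ) := by
    have hunit : ∀ (i k p : Fin m) (j l q : Fin n),
        Matrix.single i j (1 : ℂ) * (Matrix.single k l (1 : ℂ))ᴴ * Matrix.single p q (1 : ℂ) =
          if j = l ∧ k = p then Matrix.single i q 1 else 0 := by
      intro i k p j l q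
      rw [Matrix.conjTranspose_single, star_one]
      by_cases hjl : j = l
      · subst hjl
        rw [Matrix.single_mul_single_same]
        by_cases hkp : k = p
        · subst hkp
          simp
        · simp [hkp]
      · rw [Matrix.single_mul_single_of_ne (h := hjl)]
        simp [hjl]
    intro i j k l p q
    rw [hφ', hunit, hunit]
    congr 1 <;> split_ifs <;> simp
  obtain ⟨k, hk, U, hU, V, hV, h⟩ := exists_unitary_of_isRectGrid hm hn hgrid
    fun i j => (φ (Matrix.single i j 1)).2
  refine ⟨k, hk, U, hU, V, hV, fun A => ?_⟩
  rw [← h A]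
  nth_rewrite 1 [Matrix.matrix_eq_sum_single A]
  simp only [map_sum, Submodule.coe_sum]
  refine Finset.sum_congr rfl fun a _ => Finset.sum_congr rfl fun b _ => ?_
  rw [← Submodule.coe_smul, ← map_smul, Matrix.smul_single, smul_eq_mul, mul_one]
end
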